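/- arXiv:2408.01547 — 11 statements merged into one kernel-verified Lean document; each statement's English description precedes it below -/
import Mathlib

section
/- Let π : Q → P be a projection between preorders and let G ⊆ P be a filter that meets every dense open subset of P. Set Q/G := {q ∈ Q : π(q) ∈ G}. Then for every dense open subset D ⊆ Q, the set D ∩ Q/G is dense and open in the preorder Q/G (with the order inherited from Q). -/
/-- If `π : Q → P` is a projection between preorders and `G ⊆ P` is a filter
meeting every dense open subset of `P`, then for every dense open `D ⊆ Q`, the set
`D ∩ Q/G` (where `Q/G := {q : π q ∈ G}`) is dense and open in the preorder `Q/G`. -/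
theorem stmt0 {P Q : Type*} [Preorder P] [Preorder Q] (π : Q → P)
    -- `π` is a projection:
    (hsurj : Function.Surjective π) (hmono : Monotone π)
    (hproj : ∀ (p : P) (q : Q), p ≤ π q →
      ∃ q' : Q, (∃ r : Q, r ≤ q' ∧ r ≤ q) ∧ π q' ≤ p)
    -- `G` is a filter on `P`:
    (G : Set P)
    (hGne : G.Nonempty)
    (hGup : ∀ p ∈ G, ∀ p' : P, p ≤ p' → p' ∈ G)
    (hGdir : ∀ p ∈ G, ∀ p' ∈ G, ∃ r ∈ G, r ≤ p ∧ r ≤ p')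
    -- `G` meets every dense open subset of `P`:
    (hGgen : ∀ E : Set P, (∀ p : P, ∃ d ∈ E, d ≤ p) →
      (∀ d ∈ E, ∀ d' : P, d' ≤ d → d' ∈ E) → (G ∩ E).Nonempty)
    -- `D` is a dense open subset of `Q`:
    (D : Set Q)
    (hDdense : ∀ q : Q, ∃ d ∈ D, d ≤ q)
    (hDopen : ∀ d ∈ D, ∀ d' : Q, d' ≤ d → d' ∈ D) :
    -- `D ∩ Q/G` is dense in `Q/G`:
    (∀ q : Q, π q ∈ G → ∃ d : Q, (d ∈ D ∧ π d ∈ G) ∧ d ≤ q) ∧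
    -- `D ∩ Q/G` is open (downward closed) in `Q/G`:
    (∀ d : Q, (d ∈ D ∧ π d ∈ G) → ∀ d' : Q, π d' ∈ G → d' ≤ d → d' ∈ D ∧ π d' ∈ G) := by
  refine ⟨fun q hq => ?_, fun d hd d' hd' hle => ⟨hDopen d hd.1 d' hle, hd'⟩⟩
  -- Below `π q`, the downward closure of the image of `D` below `q` is dense.
  obtain ⟨p, hpG, hpE⟩ := hGgen
    {p | (∃ d ∈ D, d ≤ q ∧ p ≤ π d) ∨ ∀ s : P, s ≤ p → ¬ s ≤ π q}
    (by
      intro p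
      by_cases hp : ∃ s : P, s ≤ p ∧ s ≤ π q
      · obtain ⟨s, hsp, hsq⟩ := hp
        obtain ⟨q', ⟨r, hrq', hrq⟩, hq's⟩ := hproj s q hsq
        obtain ⟨d, hdD, hdr⟩ := hDdense r
        exact ⟨π d, Or.inl ⟨d, hdD, hdr.trans hrq, le_rfl⟩,
          (hmono (hdr.trans hrq')).trans (hq's.trans hsp)⟩
      · exact ⟨p, Or.inr fun s hsp hsq => hp ⟨s, hsp, hsq⟩, le_rfl⟩)
    (by
      rintro p (⟨d, hdD, hdq, hpd⟩ | hp) p' hp'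
      · exact Or.inl ⟨d, hdD, hdq, hp'.trans hpd⟩
      · exact Or.inr fun s hs => hp s (hs.trans hp'))
  rcases hpE with ⟨d, hdD, hdq, hpd⟩ | hp
  · exact ⟨d, ⟨hdD, hGup p hpG _ hpd⟩, hdq⟩
  · obtain ⟨r, -, hrp, hrq⟩ := hGdir p hpG _ hq
    exact absurd hrq (hp r hrp)
end

section
/- Let π : Q → P be a projection between preorders and let H ⊆ Q be a filter that meets every dense open subset of Q. Then G := {p ∈ P : there is q ∈ H with π(q) ≤ p} (the upward closure of π[H]) is a filter on P that meets every dense open subset of P. -/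
/-- If `π : Q → P` is a projection between preorders and `H ⊆ Q` is a filter
meeting every dense open subset of `Q`, then the upward closure `G` of `π[H]` is a filter
on `P` meeting every dense open subset of `P`. -/
theorem stmt1 {P Q : Type*} [Preorder P] [Preorder Q] (π : Q → P)
    -- `π` is a projection:
    (hsurj : Function.Surjective π) (hmono : Monotone π)
    (hproj : ∀ (p : P) (q : Q), p ≤ π q →
      ∃ q' : Q, (∃ r : Q, r ≤ q' ∧ r ≤ q) ∧ π q' ≤ p)
    -- `H` is a filter on `Q`:
    (H : Set Q)
    (hHne : H.Nonempty)
    (hHup : ∀ q ∈ H, ∀ q' : Q, q ≤ q' → q' ∈ H)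
    (hHdir : ∀ q ∈ H, ∀ q' ∈ H, ∃ r ∈ H, r ≤ q ∧ r ≤ q')
    -- `H` meets every dense open subset of `Q`:
    (hHgen : ∀ E : Set Q, (∀ q : Q, ∃ d ∈ E, d ≤ q) →
      (∀ d ∈ E, ∀ d' : Q, d' ≤ d → d' ∈ E) → (H ∩ E).Nonempty) :
    ∀ G : Set P, G = {p : P | ∃ q ∈ H, π q ≤ p} →
      -- `G` is a filter on `P`:
      (G.Nonempty ∧
        (∀ p ∈ G, ∀ p' : P, p ≤ p' → p' ∈ G) ∧
        (∀ p ∈ G, ∀ p' ∈ G, ∃ r ∈ G, r ≤ p ∧ r ≤ p')) ∧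
      -- `G` meets every dense open subset of `P`:
      (∀ E : Set P, (∀ p : P, ∃ d ∈ E, d ≤ p) →
        (∀ d ∈ E, ∀ d' : P, d' ≤ d → d' ∈ E) → (G ∩ E).Nonempty) := by
  rintro G rfl
  refine ⟨⟨?_, ?_, ?_⟩, ?_⟩
  · obtain ⟨q, hq⟩ := hHne
    exact ⟨π q, q, hq, le_rfl⟩
  · rintro p ⟨q, hq, hqp⟩ p' hp
    exact ⟨q, hq, hqp.trans hp⟩
  · rintro p ⟨q, hq, hqp⟩ p' ⟨q', hq', hqp'⟩
    obtain ⟨r, hr, hrq, hrq'⟩ := hHdir q hq q' hq'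
    exact ⟨π r, ⟨r, hr, le_rfl⟩, (hmono hrq).trans hqp, (hmono hrq').trans hqp'⟩
  · intro E hdense hopen
    obtain ⟨q, hqH, hqE⟩ := hHgen (π ⁻¹' E)
      (fun q ↦ by
        obtain ⟨d, hd, hdq⟩ := hdense (π q)
        obtain ⟨q', ⟨r, hrq', hrq⟩, hq'⟩ := hproj d q hdq
        exact ⟨r, hopen d hd _ ((hmono hrq').trans hq'), hrq⟩)
      (fun d hd d' hle ↦ hopen _ hd _ (hmono hle))
    exact ⟨π q, ⟨q, hqH, le_rfl⟩, hqE⟩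
end

section
/- Let ⟨P_i, π_{i,j} : i ≤ j in I⟩ be a commutative projection system over a directed partial order I with minimum element 0 that is eventually trivial, i.e., for all p, q ∈ P_0 there exists i ∈ I such that π_i(p) and π_i(q) are compatible in P_i. Then any two elements of the direct limit P_∞ are compatible (have a common lower bound in P_∞). -/
universe u v

/-- A commutative projection system over a preorder `I`: a family of preorders `P i`
together with maps `π_{i,j} : P i → P j` for `i ≤ j` that are projections
(surjective, order-preserving, and satisfying the projection property),
with `π_{i,i} = id` and `π_{j,k} ∘ π_{i,j} = π_{i,k}`. -/
structure CPS (I : Type u) [Preorder I] where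
  P : I → Type v
  ord : ∀ i : I, Preorder (P i)
  map : ∀ {i j : I}, i ≤ j → P i → P j
  map_self : ∀ {i : I} (h : i ≤ i) (p : P i), map h p = p
  map_comp : ∀ {i j k : I} (hij : i ≤ j) (hjk : j ≤ k) (p : P i),
    map hjk (map hij p) = map (hij.trans hjk) p
  map_surj : ∀ {i j : I} (h : i ≤ j), Function.Surjective (map h)
  map_mono : ∀ {i j : I} (h : i ≤ j) (p q : P i),
    (ord i).le p q → (ord j).le (map h p) (map h q)
  map_proj : ∀ {i j : I} (h : i ≤ j) (p : P j) (q : P i), (ord j).le p (map h q) →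
    ∃ q' : P i, (∃ r : P i, (ord i).le r q' ∧ (ord i).le r q) ∧ (ord j).le (map h q') p

instance CPS.instPreorder {I : Type u} [Preorder I] {S : CPS I} {i : I} :
    Preorder (S.P i) := S.ord i

/-- The equivalence relation `E` on `P 0`: `p E q` iff `π_i p = π_i q` for some `i`. -/
def CPS.setoid {I : Type u} [PartialOrder I] [OrderBot I] [IsDirected I (· ≤ ·)]
    (S : CPS I) : Setoid (S.P ⊥) where
  r p q := ∃ i : I, S.map (bot_le : (⊥ : I) ≤ i) p = S.map bot_le q
  iseqv := by
    refine ⟨fun p => ⟨⊥, rfl⟩, ?_, ?_⟩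
    · rintro p q ⟨i, h⟩; exact ⟨i, h.symm⟩
    · rintro p q r ⟨i, hi⟩ ⟨j, hj⟩
      obtain ⟨k, hik, hjk⟩ := directed_of (· ≤ ·) i j
      refine ⟨k, ?_⟩
      have h1 : S.map (bot_le : (⊥ : I) ≤ k) p = S.map hik (S.map bot_le p) :=
        (S.map_comp bot_le hik p).symm
      have h2 : S.map (bot_le : (⊥ : I) ≤ k) q = S.map hik (S.map bot_le q) :=
        (S.map_comp bot_le hik q).symm
      have h3 : S.map (bot_le : (⊥ : I) ≤ k) q = S.map hjk (S.map bot_le q) :=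
        (S.map_comp bot_le hjk q).symm
      have h4 : S.map (bot_le : (⊥ : I) ≤ k) r = S.map hjk (S.map bot_le r) :=
        (S.map_comp bot_le hjk r).symm
      rw [h1, hi, ← h2, h3, hj, ← h4]

/-- The direct limit `P_∞ := P 0 / E` of a commutative projection system. -/
def CPS.Lim {I : Type u} [PartialOrder I] [OrderBot I] [IsDirected I (· ≤ ·)]
    (S : CPS I) : Type v := Quotient S.setoid

/-- The preorder on the direct limit: `[q] ≤ [p]` iff `π_i q ≤ π_i p` for some `i`. -/
instance CPS.limPreorder {I : Type u} [PartialOrder I] [OrderBot I] [IsDirected I (· ≤ ·)]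
    (S : CPS I) : Preorder S.Lim where
  le a b := ∃ p q : S.P ⊥, Quotient.mk S.setoid p = a ∧ Quotient.mk S.setoid q = b ∧
    ∃ i : I, (S.ord i).le (S.map (bot_le : (⊥ : I) ≤ i) p) (S.map bot_le q)
  le_refl a := by
    obtain ⟨p, hp⟩ := Quotient.exists_rep a
    exact ⟨p, p, hp, hp, ⟨⊥, le_rfl⟩⟩
  le_trans a b c := by
    rintro ⟨p, q, rfl, hq, i, hi⟩ ⟨q', r, hq', rfl, j, hj⟩
    have hqq' : S.setoid.r q q' := Quotient.exact (hq.trans hq'.symm)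
    obtain ⟨m, hm⟩ := hqq'
    obtain ⟨k₁, hik₁, hmk₁⟩ := directed_of (· ≤ ·) i m
    obtain ⟨k, hk₁k, hjk⟩ := directed_of (· ≤ ·) k₁ j
    have hik : i ≤ k := hik₁.trans hk₁k
    have hmk : m ≤ k := hmk₁.trans hk₁k
    refine ⟨p, r, rfl, rfl, k, ?_⟩
    have e1 : S.map (bot_le : (⊥ : I) ≤ k) p = S.map hik (S.map bot_le p) :=
      (S.map_comp bot_le hik p).symm
    have e2 : S.map (bot_le : (⊥ : I) ≤ k) q = S.map hik (S.map bot_le q) :=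
      (S.map_comp bot_le hik q).symm
    have e3 : S.map (bot_le : (⊥ : I) ≤ k) q = S.map hmk (S.map bot_le q) :=
      (S.map_comp bot_le hmk q).symm
    have e4 : S.map (bot_le : (⊥ : I) ≤ k) q' = S.map hmk (S.map bot_le q') :=
      (S.map_comp bot_le hmk q').symm
    have e5 : S.map (bot_le : (⊥ : I) ≤ k) q' = S.map hjk (S.map bot_le q') :=
      (S.map_comp bot_le hjk q').symm
    have e6 : S.map (bot_le : (⊥ : I) ≤ k) r = S.map hjk (S.map bot_le r) :=
      (S.map_comp bot_le hjk r).symm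
    have l1 : (S.ord k).le (S.map (bot_le : (⊥ : I) ≤ k) p)
        (S.map (bot_le : (⊥ : I) ≤ k) q) := by
      rw [e1, e2]; exact S.map_mono hik _ _ hi
    have l2 : S.map (bot_le : (⊥ : I) ≤ k) q = S.map (bot_le : (⊥ : I) ≤ k) q' := by
      rw [e3, e4, hm]
    have l3 : (S.ord k).le (S.map (bot_le : (⊥ : I) ≤ k) q')
        (S.map (bot_le : (⊥ : I) ≤ k) r) := by
      rw [e5, e6]; exact S.map_mono hjk _ _ hj
    exact le_trans l1 (le_trans (le_of_eq l2) l3)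

/-- The reduced projection `π_{i,∞} : P i → P_∞`, sending `π_i p` to `[p]_E`. -/
noncomputable def CPS.projToLim {I : Type u} [PartialOrder I] [OrderBot I]
    [IsDirected I (· ≤ ·)] (S : CPS I) (i : I) (x : S.P i) : S.Lim :=
  Quotient.mk S.setoid (S.map_surj (bot_le : (⊥ : I) ≤ i) x).choose

/-- if a commutative projection system over a directed partial order with
minimum element is eventually trivial (any two elements of `P 0` have compatible images
at some index `i`), then any two elements of the direct limit `P_∞` are compatible. -/
theorem stmt3 {I : Type u} [PartialOrder I] [OrderBot I] [IsDirected I (· ≤ ·)]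
    (S : CPS I)
    (hET : ∀ p q : S.P ⊥, ∃ i : I, ∃ r : S.P i,
      (S.ord i).le r (S.map (bot_le : (⊥ : I) ≤ i) p) ∧
      (S.ord i).le r (S.map (bot_le : (⊥ : I) ≤ i) q)) :
    ∀ a b : S.Lim, ∃ c : S.Lim, c ≤ a ∧ c ≤ b := by
  intro a b
  obtain ⟨p, rfl⟩ := Quotient.exists_rep a
  obtain ⟨q, rfl⟩ := Quotient.exists_rep b
  obtain ⟨i, r, hrp, hrq⟩ := hET p q
  obtain ⟨s, rfl⟩ := S.map_surj bot_le r
  exact ⟨Quotient.mk S.setoid s, ⟨s, p, rfl, rfl, i, hrp⟩, ⟨s, q, rfl, rfl, i, hrq⟩⟩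
end

section
/- Let θ be an ordinal and for each α < θ let ⟨P^α_i, π^α_{i,j} : i ≤ j in I^α⟩ be a commutative projection system over a directed partial order I^α with minimum element. Let J := ∏_{α<θ} I^α with the pointwise order (which is directed with a minimum element). Then the family ⟨∏_{α<θ} P^α_{f(α)}, ∏_{α<θ} π^α_{f(α),g(α)} : f ≤ g in J⟩ is a commutative projection system over J, and its direct limit is order-isomorphic (as a preorder) to the full product ∏_{α<θ} P^α_∞ of the direct limits, ordered pointwise. -/
universe u v w

instance piIsDirected {A : Type*} {B : A -> Type*} [forall a, LE (B a)]
    [forall a, IsDirected (B a) (. <= .)] : IsDirected (forall a, B a) (. <= .) := by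
  constructor
  intro f g
  choose c hc1 hc2 using fun a => directed_of (. <= .) (f a) (g a)
  exact (Exists.intro c (And.intro (fun a => hc1 a) (fun a => hc2 a)))

/-- The product of a family of commutative projection systems, over the product index. -/
noncomputable def prodCPS (theta : Ordinal.{w}) (I : {a : Ordinal.{w} // a < theta} -> Type u)
    [forall a, PartialOrder (I a)] (S : forall a, CPS (I a)) : CPS (forall a, I a) where
  P f := forall a, (S a).P (f a)
  ord f := inferInstance
  map h p := fun a => (S a).map (h a) (p a)
  map_self h p := funext fun a => (S a).map_self (h a) (p a)
  map_comp hij hjk p := funext fun a => (S a).map_comp (hij a) (hjk a) (p a)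
  map_surj h q := by
    choose p hp using fun a => (S a).map_surj (h a) (q a)
    exact (Exists.intro p (funext fun a => hp a))
  map_mono h p q hpq := fun a => (S a).map_mono (h a) (p a) (q a) (hpq a)
  map_proj h p q hle := by
    have hch := fun a => (S a).map_proj (h a) (p a) (q a) (hle a)
    choose q' hq' hmap using hch
    choose r hr1 hr2 using hq'
    exact (Exists.intro q' (And.intro (Exists.intro r
      (And.intro (fun a => hr1 a) (fun a => hr2 a))) (fun a => hmap a)))

theorem CPS.mk_le_mk_iff {I : Type u} [PartialOrder I] [OrderBot I] [IsDirected I (· ≤ ·)]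
    (S : CPS.{u, v} I) (p q : S.P ⊥) :
    (show S.Lim from Quotient.mk S.setoid p) ≤ (show S.Lim from Quotient.mk S.setoid q) ↔
      ∃ i : I, (S.ord i).le (S.map (bot_le : (⊥ : I) ≤ i) p) (S.map bot_le q) := by
  refine ⟨?_, fun h => ⟨p, q, rfl, rfl, h⟩⟩
  rintro ⟨p', q', hp, hq, i, hi⟩
  obtain ⟨j, hj⟩ : ∃ j : I, S.map (bot_le : (⊥ : I) ≤ j) p' = S.map bot_le p := Quotient.exact hp
  obtain ⟨k, hk⟩ : ∃ k : I, S.map (bot_le : (⊥ : I) ≤ k) q' = S.map bot_le q := Quotient.exact hq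
  obtain ⟨l, hil, hjl⟩ := directed_of (· ≤ ·) i j
  obtain ⟨m, hlm, hkm⟩ := directed_of (· ≤ ·) l k
  refine ⟨m, ?_⟩
  have h := S.map_mono (hil.trans hlm) _ _ hi
  have h₁ := congrArg (S.map (hjl.trans hlm)) hj
  have h₂ := congrArg (S.map hkm) hk
  rw [S.map_comp, S.map_comp] at h h₁ h₂
  rwa [h₁, h₂] at h

/-- The direct limit of a product system is the product of the direct limits. -/
noncomputable def prodCPSLimIso (theta : Ordinal.{w})
    (I : {a : Ordinal.{w} // a < theta} → Type u)
    [∀ a, PartialOrder (I a)] [∀ a, OrderBot (I a)] [∀ a, IsDirected (I a) (· ≤ ·)]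
    (S : ∀ a, CPS.{u, v} (I a)) : (prodCPS theta I S).Lim ≃o (∀ a, (S a).Lim) :=
  let F : (prodCPS theta I S).Lim → ∀ a, (S a).Lim :=
    Quotient.lift (fun p a => Quotient.mk (S a).setoid (p a))
      (fun _ _ ⟨i, hi⟩ => funext fun a => Quotient.sound ⟨i a, congrFun hi a⟩)
  have hF : Function.Bijective F := by
    constructor
    · intro x y
      refine Quotient.inductionOn₂ x y fun p q h => ?_
      have h' : ∀ a, ∃ i : I a, (S a).map (bot_le : (⊥ : I a) ≤ i) (p a) =
          (S a).map bot_le (q a) := fun a => Quotient.exact (congrFun h a)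
      choose i hi using h'
      exact Quotient.sound ⟨i, funext hi⟩
    · intro y
      choose p hp using fun a => Quotient.exists_rep (y a)
      exact ⟨Quotient.mk _ p, funext hp⟩
  { Equiv.ofBijective F hF with
    map_rel_iff' := by
      intro x y
      refine Quotient.inductionOn₂ x y fun p q => ?_
      refine Iff.trans ?_ ((prodCPS theta I S).mk_le_mk_iff p q).symm
      refine (forall_congr' fun a => (S a).mk_le_mk_iff (p a) (q a)).trans ?_
      exact ⟨fun h => ⟨fun a => (h a).choose, fun a => (h a).choose_spec⟩,
        fun ⟨i, hi⟩ a => ⟨i a, hi a⟩⟩ }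

/-- the coordinatewise product of commutative projection systems is again a
commutative projection system, and its direct limit is order-isomorphic to the full
product of the direct limits of the components. -/
theorem stmt4 (theta : Ordinal.{w}) (I : {a : Ordinal.{w} // a < theta} -> Type u)
    [forall a, PartialOrder (I a)] [forall a, OrderBot (I a)]
    [forall a, IsDirected (I a) (. <= .)]
    (S : forall a, CPS (I a)) :
    -- the product maps are surjective
    (forall (f g : forall a, I a) (h : f <= g),
      Function.Surjective (fun p : forall a, (S a).P (f a) =>
        fun a => (S a).map (h a) (p a))) ∧
    -- the product maps are order-preserving
    (forall (f g : forall a, I a) (h : f <= g) (p q : forall a, (S a).P (f a)),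
      (forall a, ((S a).ord (f a)).le (p a) (q a)) ->
        forall a, ((S a).ord (g a)).le ((S a).map (h a) (p a)) ((S a).map (h a) (q a))) ∧
    -- the product maps have the projection property
    (forall (f g : forall a, I a) (h : f <= g)
        (p : forall a, (S a).P (g a)) (q : forall a, (S a).P (f a)),
      (forall a, ((S a).ord (g a)).le (p a) ((S a).map (h a) (q a))) ->
        ∃ q' : forall a, (S a).P (f a),
          (∃ r : forall a, (S a).P (f a),
            (forall a, ((S a).ord (f a)).le (r a) (q' a)) ∧
            (forall a, ((S a).ord (f a)).le (r a) (q a))) ∧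
          (forall a, ((S a).ord (g a)).le ((S a).map (h a) (q' a)) (p a))) ∧
    -- the product maps are the identity at each index and commute
    (forall (f : forall a, I a) (h : f <= f) (p : forall a, (S a).P (f a)),
      (fun a => (S a).map (h a) (p a)) = p) ∧
    (forall (f g k : forall a, I a) (hfg : f <= g) (hgk : g <= k)
        (p : forall a, (S a).P (f a)),
      (fun a => (S a).map (hgk a) ((S a).map (hfg a) (p a))) =
        (fun a => (S a).map ((hfg.trans hgk) a) (p a))) ∧
    -- the direct limit of the product system is order-isomorphic to the product of limits
    Nonempty ((prodCPS theta I S).Lim ≃o (forall a, (S a).Lim)) := by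
  exact ⟨fun _ _ h => (prodCPS theta I S).map_surj h,
    fun _ _ h => (prodCPS theta I S).map_mono h,
    fun _ _ h => (prodCPS theta I S).map_proj h,
    fun _ h => (prodCPS theta I S).map_self h,
    fun _ _ _ hfg hgk => (prodCPS theta I S).map_comp hfg hgk,
    ⟨prodCPSLimIso theta I S⟩⟩
end

section
/- Let I be a directed partial order, let W be a fine ultrafilter over I, let ⟨κ_i : i ∈ I⟩ and ⟨μ_i : i ∈ I⟩ be non-decreasing families of infinite cardinals (i ≤ j implies κ_i ≤ κ_j and μ_i ≤ μ_j) with κ := sup_i κ_i, and for each i ∈ I let U_i be a fine μ_i-complete ultrafilter over κ_i. Let λ be a regular cardinal with λ ≤ sup_i μ_i. If W is λ-complete, then the limit ultrafilter W-lim_{i∈I} U_i := {X ⊆ κ : {i ∈ I : X ∩ κ_i ∈ U_i} ∈ W} is λ-complete. -/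
universe u

/-- `U` is an ultrafilter over the set of ordinals `S`. -/
def IsUltrafilterOn (U : Set (Set Ordinal.{u})) (S : Set Ordinal.{u}) : Prop :=
  (∀ X ∈ U, X ⊆ S) ∧ S ∈ U ∧ (∅ : Set Ordinal.{u}) ∉ U ∧
    (∀ X ∈ U, ∀ Y : Set Ordinal.{u}, X ⊆ Y → Y ⊆ S → Y ∈ U) ∧
    (∀ X ∈ U, ∀ Y ∈ U, X ∩ Y ∈ U) ∧
    (∀ X : Set Ordinal.{u}, X ⊆ S → X ∈ U ∨ S \ X ∈ U)

/-- `U` is fine over the ordinal `o`: it contains every final segment of `o`. -/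
def IsFineOn (U : Set (Set Ordinal.{u})) (o : Ordinal.{u}) : Prop :=
  ∀ α < o, {β : Ordinal.{u} | α ≤ β ∧ β < o} ∈ U

/-- `U` is `μ`-complete: any (nonempty) family of fewer than `μ` members has its
intersection in `U`. -/
def IsCompleteOn (U : Set (Set Ordinal.{u})) (μ : Cardinal.{u}) : Prop :=
  ∀ (ι : Type u) [Nonempty ι] (A : ι → Set Ordinal.{u}),
    Cardinal.mk ι < μ → (∀ t, A t ∈ U) → (⋂ t, A t) ∈ U

/-- `U` is uniform over the cardinal `κ`: every member has cardinality `κ`. -/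
def IsUniformOn (U : Set (Set Ordinal.{u})) (κ : Cardinal.{u}) : Prop :=
  ∀ X ∈ U, Cardinal.mk X = Cardinal.lift.{u+1} κ

/-- `U` (an ultrafilter over the set `S` of ordinals) is `ν`-decomposable: there is
`f : S → ν` such that `f⁻¹[H] ∉ U` for every `H ⊆ ν` with `|H| < ν`. -/
def IsDecomposableOn (U : Set (Set Ordinal.{u})) (S : Set Ordinal.{u})
    (ν : Cardinal.{u}) : Prop :=
  ∃ f : Ordinal.{u} → Ordinal.{u},
    (∀ α ∈ S, f α < ν.ord) ∧
    ∀ H : Set Ordinal.{u}, H ⊆ Set.Iio ν.ord → Cardinal.mk H < Cardinal.lift.{u+1} ν →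
      {α ∈ S | f α ∈ H} ∉ U

/-- An ultrafilter `W` on a type `I` is `λ`-complete. -/
def UltrafilterCompleteOn {I : Type u} (W : Ultrafilter I) (lam : Cardinal.{u}) : Prop :=
  ∀ (ι : Type u) (A : ι → Set I), Cardinal.mk ι < lam → (∀ t, A t ∈ W) → (⋂ t, A t) ∈ W


/-- if each `U i` is a fine `μ i`-complete ultrafilter over `κ i`, `λ` is a
regular cardinal with `λ ≤ sup_i μ i`, and the fine ultrafilter `W` is `λ`-complete, then
the limit ultrafilter `W`-lim `U i` is `λ`-complete. -/
theorem stmt6 {I : Type u} [PartialOrder I] [IsDirected I (· ≤ ·)]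
    (W : Ultrafilter I) (hWfine : ∀ i : I, {j : I | i ≤ j} ∈ W)
    (κ μ : I → Cardinal.{u})
    (hκinf : ∀ i, Cardinal.aleph0 ≤ κ i) (hμinf : ∀ i, Cardinal.aleph0 ≤ μ i)
    (hκmono : Monotone κ) (hμmono : Monotone μ)
    (U : I → Set (Set Ordinal.{u}))
    (hU : ∀ i, IsUltrafilterOn (U i) (Set.Iio (κ i).ord))
    (hUfine : ∀ i, IsFineOn (U i) (κ i).ord)
    (hUcomp : ∀ i, IsCompleteOn (U i) (μ i))
    (lam : Cardinal.{u}) (hlam : lam.IsRegular) (hlamle : lam ≤ ⨆ i, μ i)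
    (hWcomp : UltrafilterCompleteOn W lam) :
    IsCompleteOn
      {X : Set Ordinal.{u} | X ⊆ Set.Iio (⨆ i, κ i).ord ∧
        {i : I | X ∩ Set.Iio (κ i).ord ∈ U i} ∈ W}
      lam := by
  intro ι _ A hι hA
  obtain ⟨i, hi⟩ := exists_lt_of_lt_ciSup' (hι.trans_le hlamle)
  refine ⟨(Set.iInter_subset A (Classical.arbitrary ι)).trans (hA _).1, ?_⟩
  have hW := hWcomp ι (fun t => {j : I | A t ∩ Set.Iio (κ j).ord ∈ U j}) hι fun t => (hA t).2
  filter_upwards [hWfine i, hW] with j hij hj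
  rw [Set.iInter_inter]
  exact hUcomp j ι _ (hi.trans_le (hμmono hij)) (Set.mem_iInter.1 hj)
end

section
/- Let I be a directed partial order, let W be a fine ultrafilter over I, let ⟨κ_i : i ∈ I⟩ and ⟨μ_i : i ∈ I⟩ be non-decreasing families of infinite cardinals (i ≤ j implies κ_i ≤ κ_j and μ_i ≤ μ_j) with κ := sup_i κ_i, and for each i ∈ I let U_i be a fine μ_i-complete ultrafilter over κ_i. Then for every cardinal ν with |I| < ν < sup_i μ_i, the limit ultrafilter W-lim_{i∈I} U_i := {X ⊆ κ : {i ∈ I : X ∩ κ_i ∈ U_i} ∈ W} is ν-indecomposable. -/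
universe u

/-- A function with fewer than `μ` values on `S` is constant on a member of a `μ`-complete
ultrafilter over `S`. -/
theorem IsUltrafilterOn.exists_fiber_mem {U : Set (Set Ordinal.{u})} {S : Set Ordinal.{u}}
    {μ ν : Cardinal.{u}} (hU : IsUltrafilterOn U S) (hcomp : IsCompleteOn U μ)
    (hν : ν ≠ 0) (hνμ : ν < μ) {f : Ordinal.{u} → Ordinal.{u}} (hf : ∀ α ∈ S, f α < ν.ord) :
    ∃ a < ν.ord, {α ∈ S | f α = a} ∈ U := by
  obtain ⟨-, -, hempty, -, -, hmax⟩ := hU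
  by_contra! hcon
  let e := Ordinal.ToType.mk (o := ν.ord)
  have hne : Nonempty ν.ord.ToType :=
    Ordinal.nonempty_toType_iff.2 (by simpa using hν)
  have hmem : (⋂ t : ν.ord.ToType, S \ {α ∈ S | f α = (e.symm t : Ordinal.{u})}) ∈ U :=
    hcomp _ _ (by simpa using hνμ) fun t =>
      (hmax _ (Set.sep_subset _ _)).resolve_left (hcon _ (e.symm t).2)
  refine hempty ?_
  convert hmem
  symm
  rw [Set.eq_empty_iff_forall_notMem]
  intro α hα
  rw [Set.mem_iInter] at hα
  have hS : α ∈ S := (hα hne.some).1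
  exact (hα (e ⟨f α, hf α hS⟩)).2 ⟨hS, by simp⟩

/-- if each `U i` is a fine `μ i`-complete ultrafilter over `κ i` and `W` is a
fine ultrafilter over the directed partial order `I`, then for every (infinite) cardinal
`ν` with `|I| < ν < sup_i μ i`, the limit ultrafilter `W`-lim `U i` is `ν`-indecomposable. -/
theorem stmt7 {I : Type u} [PartialOrder I] [IsDirected I (· ≤ ·)]
    (W : Ultrafilter I) (hWfine : ∀ i : I, {j : I | i ≤ j} ∈ W)
    (κ μ : I → Cardinal.{u})
    (hκinf : ∀ i, Cardinal.aleph0 ≤ κ i) (hμinf : ∀ i, Cardinal.aleph0 ≤ μ i)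
    (hκmono : Monotone κ) (hμmono : Monotone μ)
    (U : I → Set (Set Ordinal.{u}))
    (hU : ∀ i, IsUltrafilterOn (U i) (Set.Iio (κ i).ord))
    (hUfine : ∀ i, IsFineOn (U i) (κ i).ord)
    (hUcomp : ∀ i, IsCompleteOn (U i) (μ i))
    (ν : Cardinal.{u}) (hν : Cardinal.aleph0 ≤ ν)
    (hIν : Cardinal.mk I < ν) (hνμ : ν < ⨆ i, μ i) :
    ¬ IsDecomposableOn
      {X : Set Ordinal.{u} | X ⊆ Set.Iio (⨆ i, κ i).ord ∧
        {i : I | X ∩ Set.Iio (κ i).ord ∈ U i} ∈ W}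
      (Set.Iio (⨆ i, κ i).ord) ν := by
  rintro ⟨f, hf, hdec⟩
  obtain ⟨i₀, hi₀⟩ := exists_lt_of_lt_ciSup' hνμ
  have hκle (j : I) : Set.Iio (κ j).ord ⊆ Set.Iio (⨆ i, κ i).ord :=
    Set.Iio_subset_Iio (Cardinal.ord_le_ord.2 (le_ciSup Cardinal.bddAbove_of_small j))
  have hfiber (j : I) : ∃ a, i₀ ≤ j → a < ν.ord ∧ {α ∈ Set.Iio (κ j).ord | f α = a} ∈ U j := by
    by_cases hj : i₀ ≤ j
    · obtain ⟨a, ha, hmem⟩ := (hU j).exists_fiber_mem (hUcomp j)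
        (Cardinal.aleph0_pos.trans_le hν).ne' (hi₀.trans_le (hμmono hj))
        fun α hα => hf α (hκle j hα)
      exact ⟨a, fun _ => ⟨ha, hmem⟩⟩
    · exact ⟨0, fun h => absurd h hj⟩
  choose a ha using hfiber
  refine hdec (a '' {j | i₀ ≤ j}) ?_ ?_ ⟨Set.sep_subset _ _, ?_⟩
  · rintro _ ⟨j, hj, rfl⟩
    exact (ha j hj).1
  · calc Cardinal.mk (a '' {j | i₀ ≤ j}) ≤ Cardinal.mk (Set.range a) :=
          Cardinal.mk_le_mk_of_subset (Set.image_subset_range _ _)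
      _ ≤ Cardinal.lift.{u+1} (Cardinal.mk I) := by
          rw [← Cardinal.lift_id'.{u, u+1} (Cardinal.mk (Set.range a))]
          exact Cardinal.mk_range_le_lift
      _ < Cardinal.lift.{u+1} ν := Cardinal.lift_lt.2 hIν
  · refine Filter.mem_of_superset (hWfine i₀) fun j hj => ?_
    refine (hU j).2.2.2.1 _ (ha j hj).2 _ ?_ Set.inter_subset_right
    rintro α ⟨hα, hfα⟩
    exact ⟨⟨hκle j hα, j, hj, hfα.symm⟩, hα⟩
end

section
/- Suppose δ < κ is a pair of infinite regular cardinals. If there exists a κ-Aronszajn tree carrying a δ-ascent path, then every uniform ultrafilter over κ is δ-decomposable. -/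
universe u

/-- A node of a binary tree: a pair `(α, s)` coding the function `t : α → 2` whose value
is `1` exactly on `s ⊆ α`. -/
abbrev TreeNode : Type (u+1) := Ordinal.{u} × Set Ordinal.{u}

/-- The tree order: `s` is an initial segment of `t`. -/
def TreeLE (s t : TreeNode.{u}) : Prop :=
  s.1 ≤ t.1 ∧ s.2 = t.2 ∩ Set.Iio s.1

/-- A binary tree: a set of nodes closed under restrictions. -/
def IsBinaryTree (T : Set TreeNode.{u}) : Prop :=
  (∀ t ∈ T, t.2 ⊆ Set.Iio t.1) ∧
  (∀ t ∈ T, ∀ β ≤ t.1, ((β, t.2 ∩ Set.Iio β) : TreeNode.{u}) ∈ T)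

/-- A `κ`-tree: a binary tree of height `κ` all of whose levels have size `< κ`. -/
def IsKappaTree (κ : Cardinal.{u}) (T : Set TreeNode.{u}) : Prop :=
  IsBinaryTree T ∧
  (∀ t ∈ T, t.1 < κ.ord) ∧
  (∀ α < κ.ord, ∃ t ∈ T, t.1 = α) ∧
  (∀ α < κ.ord, Cardinal.mk {t : TreeNode.{u} // t ∈ T ∧ t.1 = α} < Cardinal.lift.{u+1} κ)

/-- A `κ`-Aronszajn tree: a `κ`-tree with no chain of size `κ`. -/
def IsAronszajnTree (κ : Cardinal.{u}) (T : Set TreeNode.{u}) : Prop :=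
  IsKappaTree κ T ∧
  ¬ ∃ B : Set TreeNode.{u}, B ⊆ T ∧
      (∀ s ∈ B, ∀ t ∈ B, TreeLE s t ∨ TreeLE t s) ∧
      Cardinal.mk B = Cardinal.lift.{u+1} κ


/-- A `δ`-ascent path through a tree `T` of height `κ`: functions `f_β : δ → T_β` such
that for all `α < β < κ`, `f_α(i)` is below `f_β(i)` for all but boundedly many `i < δ`. -/
def IsDeltaAscentPath (κ δ : Cardinal.{u}) (T : Set TreeNode.{u})
    (f : Ordinal.{u} → Ordinal.{u} → TreeNode.{u}) : Prop :=
  (∀ β < κ.ord, ∀ i < δ.ord, f β i ∈ T ∧ (f β i).1 = β) ∧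
  (∀ α β : Ordinal.{u}, α < β → β < κ.ord →
    ∃ i₀ < δ.ord, ∀ i : Ordinal.{u}, i₀ ≤ i → i < δ.ord → TreeLE (f α i) (f β i))

open Cardinal

/-- Nodes below a common node are comparable, in the order of their heights. -/
theorem TreeLE.of_common_upper_bound {r s t : TreeNode.{u}} (hs : TreeLE s r) (ht : TreeLE t r)
    (hst : s.1 ≤ t.1) : TreeLE s t := by
  refine ⟨hst, ?_⟩
  rw [hs.2, ht.2, Set.inter_assoc, Set.inter_eq_right.2 (Set.Iio_subset_Iio hst)]

/-- If `U` is not `δ`-decomposable, then every function into `δ` is bounded on a member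
of `U`. -/
theorem exists_bound_mem_of_not_isDecomposableOn {U : Set (Set Ordinal.{u})}
    {S : Set Ordinal.{u}} {δ : Cardinal.{u}} (hδ : δ.IsRegular) (hU : IsUltrafilterOn U S)
    (hD : ¬ IsDecomposableOn U S δ) {g : Ordinal.{u} → Ordinal.{u}}
    (hg : ∀ α ∈ S, g α < δ.ord) : ∃ j < δ.ord, {α ∈ S | g α ≤ j} ∈ U := by
  have : ∃ H : Set Ordinal.{u}, H ⊆ Set.Iio δ.ord ∧ #H < Cardinal.lift.{u + 1} δ ∧
      {α ∈ S | g α ∈ H} ∈ U := by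
    by_contra! h
    exact hD ⟨g, hg, h⟩
  obtain ⟨H, hH, hcard, hmem⟩ := this
  refine ⟨sSup H, Ordinal.sSup_lt_of_lt_cof ?_ hH, ?_⟩
  · rwa [← Ordinal.lift_cof, hδ.cof_ord]
  · exact hU.2.2.2.1 _ hmem _
      (fun α hα => ⟨hα.1, le_csSup ⟨δ.ord, fun x hx => (hH hx).le⟩ hα.2⟩) fun α hα => hα.1

/-- A uniform ultrafilter over `κ` contains every final segment of `κ`. -/
theorem IsUniformOn.tail_mem {U : Set (Set Ordinal.{u})} {κ : Cardinal.{u}} (hκ : ℵ₀ ≤ κ)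
    (hU : IsUltrafilterOn U (Set.Iio κ.ord)) (hun : IsUniformOn U κ) {α : Ordinal.{u}}
    (hα : α < κ.ord) : Set.Iio κ.ord \ Set.Iio (α + 1) ∈ U := by
  have hα' : α + 1 < κ.ord := by
    simpa using (isSuccLimit_ord hκ).succ_lt hα
  refine (hU.2.2.2.2.2 _ (Set.Iio_subset_Iio hα'.le)).resolve_left fun h => ?_
  have h' := hun _ h
  rw [mk_Iio_ordinal, Cardinal.lift_inj] at h'
  exact (lt_ord.1 hα').ne h'

/-- If the `j`-th nodes of an ascent path at `κ` many levels have pairwise upper bounds, then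
they form a chain of size `κ`. -/
theorem IsDeltaAscentPath.exists_chain {δ κ : Cardinal.{u}} {T : Set TreeNode.{u}}
    {f : Ordinal.{u} → Ordinal.{u} → TreeNode.{u}} (hf : IsDeltaAscentPath κ δ T f)
    {A : Set Ordinal.{u}} (hA : A ⊆ Set.Iio κ.ord) (hcard : #A = Cardinal.lift.{u + 1} κ)
    {j : Ordinal.{u}} (hj : j < δ.ord)
    (h : ∀ α ∈ A, ∀ β ∈ A, ∃ γ, TreeLE (f α j) (f γ j) ∧ TreeLE (f β j) (f γ j)) :
    ∃ B : Set TreeNode.{u}, B ⊆ T ∧ (∀ s ∈ B, ∀ t ∈ B, TreeLE s t ∨ TreeLE t s) ∧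
      #B = Cardinal.lift.{u + 1} κ := by
  refine ⟨(fun α => f α j) '' A, ?_, ?_, ?_⟩
  · rintro _ ⟨α, hα, rfl⟩
    exact (hf.1 α (hA hα) j hj).1
  · rintro _ ⟨α, hα, rfl⟩ _ ⟨β, hβ, rfl⟩
    obtain ⟨γ, h₁, h₂⟩ := h α hα β hβ
    exact (le_total (f α j).1 (f β j).1).imp (h₁.of_common_upper_bound h₂)
      (h₂.of_common_upper_bound h₁)
  · rw [mk_image_eq_of_injOn, hcard]
    intro α hα β hβ hαβ
    rw [← (hf.1 α (hA hα) j hj).2, ← (hf.1 β (hA hβ) j hj).2]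
    exact congrArg Prod.fst hαβ

/-- if `δ < κ` are infinite regular cardinals and there is a `κ`-Aronszajn
tree with a `δ`-ascent path, then every uniform ultrafilter over `κ` is
`δ`-decomposable. -/
theorem stmt9 (δ κ : Cardinal.{u}) (hδ : δ.IsRegular) (hκ : κ.IsRegular) (hδκ : δ < κ)
    (T : Set TreeNode.{u}) (f : Ordinal.{u} → Ordinal.{u} → TreeNode.{u})
    (hT : IsAronszajnTree κ T) (hf : IsDeltaAscentPath κ δ T f) :
    ∀ U : Set (Set Ordinal.{u}), IsUltrafilterOn U (Set.Iio κ.ord) → IsUniformOn U κ →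
      IsDecomposableOn U (Set.Iio κ.ord) δ := by
  intro U hU hun
  by_contra hD
  have key : ∀ α : Set.Iio κ.ord, ∃ j : Set.Iio δ.ord,
      {β | β < κ.ord ∧ ∀ i, j.1 ≤ i → i < δ.ord → TreeLE (f α i) (f β i)} ∈ U := by
    rintro ⟨α, hα⟩
    have hex : ∀ β, ∃ i₀ < δ.ord, α < β → β < κ.ord →
        ∀ i, i₀ ≤ i → i < δ.ord → TreeLE (f α i) (f β i) := by
      intro β
      by_cases hβ : α < β ∧ β < κ.ord
      · obtain ⟨i₀, hi₀, h⟩ := hf.2 α β hβ.1 hβ.2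
        exact ⟨i₀, hi₀, fun _ _ => h⟩
      · exact ⟨0, hδ.ord_pos, fun h₁ h₂ => absurd ⟨h₁, h₂⟩ hβ⟩
    choose g hg hgle using hex
    obtain ⟨j, hj, hjU⟩ := exists_bound_mem_of_not_isDecomposableOn hδ hU hD fun β _ => hg β
    refine ⟨⟨j, hj⟩, hU.2.2.2.1 _ (hU.2.2.2.2.1 _ hjU _ (hun.tail_mem hκ.aleph0_le hU hα)) _
      ?_ fun β hβ => hβ.1⟩
    rintro β ⟨⟨hβ, hgj⟩, -, hαβ⟩
    have hαβ : α < β := by simpa using hαβ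
    exact ⟨hβ, fun i hi => hgle β hαβ hβ i (hgj.trans hi)⟩
  choose J hJ using key
  have hκcard : #(Set.Iio κ.ord) = Cardinal.lift.{u + 1} κ := by simp [mk_Iio_ordinal]
  have hδcard : #(Set.Iio δ.ord) = Cardinal.lift.{u + 1} δ := by simp [mk_Iio_ordinal]
  obtain ⟨j, hj⟩ := infinite_pigeonhole J (by simpa [hκcard] using hκ.aleph0_le) (by
    rw [hκcard, hκ.lift.cof_ord, hδcard]
    exact Cardinal.lift_lt.2 hδκ)
  refine hT.2 (hf.exists_chain (A := Subtype.val '' (J ⁻¹' {j})) ?_ ?_ j.2 ?_)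
  · rintro _ ⟨α, -, rfl⟩
    exact α.2
  · rw [mk_image_eq Subtype.val_injective, hj, hκcard]
  · rintro _ ⟨α, rfl, rfl⟩ _ ⟨β, hβ, rfl⟩
    have hαβ := hU.2.2.2.2.1 _ (hJ α) _ (hJ β)
    obtain ⟨γ, hγ⟩ := Set.nonempty_iff_ne_empty.2 fun h => hU.2.2.1 (h ▸ hαβ)
    exact ⟨γ, hγ.1.2 _ le_rfl (J α).2, hγ.2.2 _ (le_of_eq (congrArg _ hβ)) (J α).2⟩
end

section
/- Suppose δ < κ is a pair of infinite regular cardinals and there exists a κ-Aronszajn tree carrying a δ-ascent path. Then for every cardinal λ > δ, there is no λ-complete uniform ultrafilter over κ. -/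
universe u

/-- Two initial segments of the same node are comparable. -/
theorem TreeLE.comparable {s t r : TreeNode.{u}} (hs : TreeLE s r) (ht : TreeLE t r) :
    TreeLE s t ∨ TreeLE t s := by
  have key : ∀ {a b : TreeNode.{u}}, TreeLE a r → TreeLE b r → a.1 ≤ b.1 → TreeLE a b := by
    intro a b ha hb hab
    refine ⟨hab, ?_⟩
    rw [ha.2, hb.2, Set.inter_assoc, Set.inter_eq_right.2 (Set.Iio_subset_Iio hab)]
  rcases le_total s.1 t.1 with h | h
  · exact Or.inl (key hs ht h)
  · exact Or.inr (key ht hs h)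

/-- A uniform ultrafilter over an infinite cardinal contains every final segment. -/
theorem IsUltrafilterOn.Ioo_mem {κ : Cardinal.{u}} (hκ : Cardinal.aleph0 ≤ κ)
    {U : Set (Set Ordinal.{u})} (hU : IsUltrafilterOn U (Set.Iio κ.ord))
    (hun : IsUniformOn U κ) {α : Ordinal.{u}} (hα : α < κ.ord) :
    Set.Ioo α κ.ord ∈ U := by
  obtain ⟨-, -, -, -, -, hdich⟩ := hU
  rcases hdich (Set.Ioo α κ.ord) (fun x hx => hx.2) with h | h
  · exact h
  · have hsub : Set.Iio κ.ord \ Set.Ioo α κ.ord ⊆ Set.Iio (Order.succ α) := fun x hx =>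
      Order.lt_succ_iff.2 (not_lt.1 fun hlt => hx.2 ⟨hlt, hx.1⟩)
    have hle := Cardinal.mk_le_mk_of_subset hsub
    rw [hun _ h, Cardinal.mk_Iio_ordinal, Cardinal.lift_le] at hle
    exact absurd hle (not_le.2 (Cardinal.lt_ord.1
      ((Cardinal.isSuccLimit_ord hκ).succ_lt hα)))

/-- A sufficiently complete ultrafilter stabilizes a choice among few possibilities:
if every point of a set in `U` satisfies `P i` for some `i < δ`, then a single `i` works
on a set in `U`. -/
theorem IsUltrafilterOn.exists_mem_of_isCompleteOn {S : Set Ordinal.{u}}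
    {U : Set (Set Ordinal.{u})} (hU : IsUltrafilterOn U S) {δ lam : Cardinal.{u}}
    (hδ : δ ≠ 0) (hlam : δ < lam) (hc : IsCompleteOn U lam) {Y : Set Ordinal.{u}} (hY : Y ∈ U)
    (P : Ordinal.{u} → Ordinal.{u} → Prop) (hP : ∀ β ∈ Y, ∃ i < δ.ord, P i β) :
    ∃ i < δ.ord, {β ∈ Y | P i β} ∈ U := by
  obtain ⟨hsub, -, hempty, -, hinter, hdich⟩ := hU
  by_contra! hcon
  have hmk : Cardinal.mk δ.ord.ToType = δ := Cardinal.mk_ord_toType δ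
  have : Nonempty δ.ord.ToType := Cardinal.mk_ne_zero_iff.1 (hmk.trans_ne hδ)
  let e := Ordinal.ToType.mk (o := δ.ord)
  have hmem := hc δ.ord.ToType (fun t => S \ {β ∈ Y | P (e.symm t) β}) (hmk.trans_lt hlam) fun t =>
    (hdich _ fun β hβ => hsub Y hY hβ.1).resolve_left (hcon _ (e.symm t).2)
  refine hempty ?_
  convert hinter _ hY _ hmem
  refine (Set.eq_empty_iff_forall_notMem.2 fun β hβ => ?_).symm
  obtain ⟨i, hi, hPi⟩ := hP β hβ.1
  refine (Set.mem_iInter.1 hβ.2 (e ⟨i, hi⟩)).2 ⟨hβ.1, ?_⟩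
  simpa using hPi

/-- if `δ < κ` are infinite regular cardinals and there is a `κ`-Aronszajn
tree with a `δ`-ascent path, then for every cardinal `λ > δ` there is no `λ`-complete
uniform ultrafilter over `κ`. -/
theorem stmt10 (δ κ : Cardinal.{u}) (hδ : δ.IsRegular) (hκ : κ.IsRegular) (hδκ : δ < κ)
    (T : Set TreeNode.{u}) (f : Ordinal.{u} → Ordinal.{u} → TreeNode.{u})
    (hT : IsAronszajnTree κ T) (hf : IsDeltaAscentPath κ δ T f) :
    ∀ lam : Cardinal.{u}, δ < lam →
      ¬ ∃ U : Set (Set Ordinal.{u}),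
        IsUltrafilterOn U (Set.Iio κ.ord) ∧ IsCompleteOn U lam ∧ IsUniformOn U κ := by
  rintro lam hlam ⟨U, hU, hc, hun⟩
  obtain ⟨hnode, hasc⟩ := hf
  have hstab : ∀ α : Set.Iio κ.ord, ∃ i : Set.Iio δ.ord,
      {β ∈ Set.Ioo α.1 κ.ord | ∀ j, i.1 ≤ j → j < δ.ord → TreeLE (f α.1 j) (f β j)} ∈ U := by
    rintro ⟨α, hα⟩
    obtain ⟨i, hi, h⟩ := hU.exists_mem_of_isCompleteOn hδ.pos.ne' hlam hc
      (hU.Ioo_mem hκ.aleph0_le hun hα)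
      (fun i β => ∀ j, i ≤ j → j < δ.ord → TreeLE (f α j) (f β j))
      (fun β hβ => hasc α β hβ.1 hβ.2)
    exact ⟨⟨i, hi⟩, h⟩
  choose g hg using hstab
  have hmkκ : Cardinal.mk (Set.Iio κ.ord) = Cardinal.lift.{u+1} κ := by
    rw [Cardinal.mk_Iio_ordinal, Cardinal.card_ord]
  obtain ⟨i, hi⟩ := Cardinal.infinite_pigeonhole g
    (by rw [hmkκ]; exact Cardinal.aleph0_le_lift.2 hκ.aleph0_le)
    (by
      rw [hmkκ, Cardinal.mk_Iio_ordinal, Cardinal.card_ord]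
      rw [← Cardinal.lift_ord, ← Ordinal.lift_cof, hκ.cof_ord]
      exact Cardinal.lift_lt.2 hδκ)
  refine hT.2 ⟨(fun α : Set.Iio κ.ord => f α.1 i.1) '' (g ⁻¹' {i}), ?_, ?_, ?_⟩
  · rintro _ ⟨α, -, rfl⟩
    exact (hnode α α.2 i i.2).1
  · rintro _ ⟨α, rfl, rfl⟩ _ ⟨α', hα', rfl⟩
    obtain ⟨-, -, hempty, -, hinter, -⟩ := hU
    obtain ⟨β, hβ, hβ'⟩ : (_ ∩ _ : Set Ordinal.{u}).Nonempty :=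
      Set.nonempty_iff_ne_empty.2 fun h => hempty (h ▸ hinter _ (hg α) _ (hg α'))
    exact (hβ.2 _ le_rfl (g α).2).comparable (hβ'.2 _ (congrArg Subtype.val hα').le (g α).2)
  · rw [Cardinal.mk_image_eq_of_injOn, hi, hmkκ]
    intro α _ α' _ h
    have h1 := congrArg Prod.fst h
    simp only [(hnode α α.2 i i.2).2, (hnode α' α'.2 i i.2).2] at h1
    exact Subtype.ext h1
end

section
/- Let κ be an infinite cardinal, T a κ-tree, D a fine filter over a directed partial order I, ⟨f_β : β < κ⟩ a D-ascent path through T, and (Y_0, B_0), (Y_1, B_1) two threads through ⟨f_β : β < κ⟩. Define g on B_1 by g(β) := {i ∈ Y_0 ∩ Y_1 : f_β(i) ⊆ f_{min(B_0 \ β)}(i)}. Then g(β) ∈ D for every β ∈ B_1, and for all α < β in B_1, g(β) ⊆ g(α). -/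
universe u

/-- A `D`-ascent path through a tree of height `κ`: functions `f_β : I → T_β` such that
for all `α < β < κ`, `{i : f_α(i) ⊆ f_β(i)} ∈ D`. -/
def IsAscentPath {I : Type u} [Preorder I] (κ : Cardinal.{u}) (T : Set TreeNode.{u})
    (D : Filter I) (f : Ordinal.{u} → I → TreeNode.{u}) : Prop :=
  (∀ β < κ.ord, ∀ i : I, f β i ∈ T ∧ (f β i).1 = β) ∧
  (∀ α β : Ordinal.{u}, α < β → β < κ.ord → {i : I | TreeLE (f α i) (f β i)} ∈ D)

/-- A thread `(Y, B)` through a `D`-ascent path `f`. -/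
def IsThread {I : Type u} [Preorder I] (κ : Cardinal.{u}) (D : Filter I)
    (f : Ordinal.{u} → I → TreeNode.{u}) (Y : Set I) (B : Set Ordinal.{u}) : Prop :=
  Y ∈ D ∧
  B ⊆ Set.Iio κ.ord ∧
  (∀ α < κ.ord, ∃ β ∈ B, α ≤ β) ∧
  (∀ α ∈ B, ∀ β ∈ B, α < β → ∀ i ∈ Y, TreeLE (f α i) (f β i)) ∧
  (∀ α < κ.ord, (∃ β ∈ B, α < β ∧ ∀ i ∈ Y, TreeLE (f α i) (f β i)) → α ∈ B)

/-- `B^X := {α < κ : f_α(i) ⊆ f_{min(B \ α)}(i) for all i ∈ X}`. -/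
def threadRestrict {I : Type u} [Preorder I] (κ : Cardinal.{u})
    (f : Ordinal.{u} → I → TreeNode.{u}) (B : Set Ordinal.{u}) (X : Set I) :
    Set Ordinal.{u} :=
  {α : Ordinal.{u} | α < κ.ord ∧
    ∀ i ∈ X, TreeLE (f α i) (f (sInf {β : Ordinal.{u} | β ∈ B ∧ α ≤ β}) i)}

/-- Every node of a binary tree extends itself. -/
theorem IsBinaryTree.treeLE_refl {T : Set TreeNode.{u}} (hT : IsBinaryTree T) {t : TreeNode.{u}}
    (ht : t ∈ T) : TreeLE t t :=
  ⟨le_rfl, (Set.inter_eq_left.2 (hT.1 t ht)).symm⟩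

theorem TreeLE.trans {r s t : TreeNode.{u}} (h : TreeLE r s) (h' : TreeLE s t) : TreeLE r t := by
  refine ⟨h.1.trans h'.1, ?_⟩
  rw [h.2, h'.2, Set.inter_assoc, Set.inter_eq_right.2 (Set.Iio_subset_Iio h.1)]

/-- Two initial segments of the same node are comparable. -/
theorem TreeLE.of_le_of_le {r s t : TreeNode.{u}} (hr : TreeLE r t) (hs : TreeLE s t)
    (h : r.1 ≤ s.1) : TreeLE r s := by
  refine ⟨h, ?_⟩
  rw [hr.2, hs.2, Set.inter_assoc, Set.inter_eq_right.2 (Set.Iio_subset_Iio h)]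

/-- for threads `(Y₀, B₀)` and `(Y₁, B₁)` through a `D`-ascent path, the
function `g(β) := {i ∈ Y₀ ∩ Y₁ : f_β(i) ⊆ f_{min(B₀ \ β)}(i)}` on `B₁` takes values in
`D` and is antitone. -/
theorem stmt12 {I : Type u} [PartialOrder I] [IsDirected I (· ≤ ·)]
    (κ : Cardinal.{u}) (hκ : Cardinal.aleph0 ≤ κ)
    (T : Set TreeNode.{u}) (hT : IsKappaTree κ T)
    (D : Filter I) (hDne : D.NeBot) (hDfine : ∀ i : I, {j : I | i ≤ j} ∈ D)
    (f : Ordinal.{u} → I → TreeNode.{u}) (hf : IsAscentPath κ T D f)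
    (Y₀ Y₁ : Set I) (B₀ B₁ : Set Ordinal.{u})
    (h₀ : IsThread κ D f Y₀ B₀) (h₁ : IsThread κ D f Y₁ B₁) :
    ∀ g : Ordinal.{u} → Set I,
      (∀ β ∈ B₁, g β =
        {i : I | i ∈ Y₀ ∩ Y₁ ∧
          TreeLE (f β i) (f (sInf {γ : Ordinal.{u} | γ ∈ B₀ ∧ β ≤ γ}) i)}) →
      (∀ β ∈ B₁, g β ∈ D) ∧ (∀ α ∈ B₁, ∀ β ∈ B₁, α < β → g β ⊆ g α) := by
  intro g hg
  have hrefl : ∀ β < κ.ord, ∀ i, TreeLE (f β i) (f β i) := fun β hβ i =>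
    hT.1.treeLE_refl (hf.1 β hβ i).1
  obtain ⟨hY₀, hB₀, hcof₀, hthr₀, -⟩ := h₀
  obtain ⟨hY₁, hB₁, -, hthr₁, -⟩ := h₁
  have hmin : ∀ β ∈ B₁, sInf {γ : Ordinal.{u} | γ ∈ B₀ ∧ β ≤ γ} ∈ B₀ ∧
      β ≤ sInf {γ : Ordinal.{u} | γ ∈ B₀ ∧ β ≤ γ} := fun β hβ =>
    csInf_mem (s := {γ : Ordinal.{u} | γ ∈ B₀ ∧ β ≤ γ}) (hcof₀ β (hB₁ hβ))
  refine ⟨fun β hβ => ?_, fun α hα β hβ hαβ i hi => ?_⟩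
  · rw [hg β hβ]
    obtain ⟨hm, hle⟩ := hmin β hβ
    refine Filter.inter_mem (Filter.inter_mem hY₀ hY₁) ?_
    rcases hle.eq_or_lt with heq | hlt
    · rw [← heq]
      exact Filter.univ_mem' (hrefl β (hB₁ hβ))
    · exact hf.2 _ _ hlt (hB₀ hm)
  · rw [hg β hβ] at hi
    rw [hg α hα]
    obtain ⟨hiY, hi⟩ := hi
    obtain ⟨hmα, hleα⟩ := hmin α hα
    obtain ⟨hmβ, hleβ⟩ := hmin β hβ
    refine ⟨hiY, ((hthr₁ α hα β hβ hαβ i hiY.2).trans hi).of_le_of_le ?_ ?_⟩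
    · have hle : sInf {γ : Ordinal.{u} | γ ∈ B₀ ∧ α ≤ γ} ≤
          sInf {γ : Ordinal.{u} | γ ∈ B₀ ∧ β ≤ γ} :=
        csInf_le' ⟨hmβ, hαβ.le.trans hleβ⟩
      rcases hle.eq_or_lt with heq | hlt
      · rw [heq]
        exact hrefl _ (hB₀ hmβ) i
      · exact hthr₀ _ hmα _ hmβ hlt i hiY.1
    · rw [(hf.1 α (hB₁ hα) i).2, (hf.1 _ (hB₀ hmα) i).2]
      exact hleα
end

section
/- Suppose κ is an infinite cardinal with κ^{<κ} = κ, δ ≤ κ is an infinite regular cardinal, and ⟨S_γ : γ < δ⟩ is a sequence of pairwise disjoint stationary subsets of E^{κ⁺}_κ. Then the full product poset ∏_{γ<δ} CU(κ⁺ \ S_{1+γ}) (ordered coordinatewise, with 1+γ denoting ordinal addition) is κ-distributive: for every family of at most κ many dense open subsets of the product, the intersection of the family is dense open. -/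
universe u

/-- `C` is closed below `o`: it contains each of its limit points `< o`. -/
def IsClosedIn (C : Set Ordinal.{u}) (o : Ordinal.{u}) : Prop :=
  ∀ α < o, α ≠ 0 → sSup (C ∩ Set.Iio α) = α → α ∈ C

/-- `C` is a club in `o`: a closed unbounded subset of `o`. -/
def IsClubIn (C : Set Ordinal.{u}) (o : Ordinal.{u}) : Prop :=
  C ⊆ Set.Iio o ∧ IsClosedIn C o ∧ ∀ α < o, ∃ β ∈ C, α < β

/-- `S` is stationary in `o`: it meets every club in `o`. -/
def IsStationaryIn (S : Set Ordinal.{u}) (o : Ordinal.{u}) : Prop :=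
  S ⊆ Set.Iio o ∧ ∀ C : Set Ordinal.{u}, IsClubIn C o → (S ∩ C).Nonempty

/-- A condition of the poset `CU(F)`: a nonempty closed bounded subset `c` of `o`
with `c ⊆ F`. -/
def CUCond (F : Set Ordinal.{u}) (o : Ordinal.{u}) (c : Set Ordinal.{u}) : Prop :=
  c.Nonempty ∧ c ⊆ F ∧ c ⊆ Set.Iio o ∧ (∃ β < o, c ⊆ Set.Iic β) ∧ IsClosedIn c o

/-- `c'` extends `c` in `CU(F)`: `c' ∩ (max c + 1) = c`. -/
def CUExt (c' c : Set Ordinal.{u}) : Prop :=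
  c' ∩ Set.Iic (sSup c) = c

/-- A condition of the full product `∏_{γ<δ} CU(κ⁺ \ S_{1+γ})`. -/
def ProdCond (κ δ : Cardinal.{u}) (S : Ordinal.{u} → Set Ordinal.{u})
    (p : Ordinal.{u} → Set Ordinal.{u}) : Prop :=
  ∀ γ < δ.ord, CUCond (Set.Iio (Order.succ κ).ord \ S (1 + γ)) (Order.succ κ).ord (p γ)

/-- Coordinatewise extension in the full product. -/
def ProdExt (δ : Cardinal.{u}) (p' p : Ordinal.{u} → Set Ordinal.{u}) : Prop :=
  ∀ γ < δ.ord, CUExt (p' γ) (p γ)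


theorem CUExt.subset {c' c : Set Ordinal.{u}} (h : CUExt c' c) : c ⊆ c' :=
  h ▸ Set.inter_subset_left

theorem CUExt.mem {c' c : Set Ordinal.{u}} (h : CUExt c' c) {x : Ordinal.{u}} (hx : x ∈ c')
    (hxc : x ≤ sSup c) : x ∈ c := by
  rw [← h]
  exact ⟨hx, hxc⟩

theorem CUExt.of_subset {c' c : Set Ordinal.{u}} (hb : BddAbove c) (h : c ⊆ c')
    (h' : ∀ x ∈ c', x ≤ sSup c → x ∈ c) : CUExt c' c :=
  Set.Subset.antisymm (fun x hx ↦ h' x hx.1 hx.2) fun _ hx ↦ ⟨h hx, le_csSup hb hx⟩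

theorem CUCond.bddAbove {F : Set Ordinal.{u}} {o : Ordinal.{u}} {c : Set Ordinal.{u}}
    (h : CUCond F o c) : BddAbove c :=
  let ⟨β, _, hβ⟩ := h.2.2.2.1
  ⟨β, hβ⟩

theorem CUCond.sSup_mem {F : Set Ordinal.{u}} {o : Ordinal.{u}} {c : Set Ordinal.{u}}
    (h : CUCond F o c) : sSup c ∈ c := by
  obtain ⟨β, hβo, hβ⟩ := h.2.2.2.1
  by_contra hc
  have hlt : ∀ x ∈ c, x < sSup c := fun x hx ↦
    (le_csSup h.bddAbove hx).lt_of_ne fun he ↦ hc (he ▸ hx)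
  obtain ⟨x, hx⟩ := h.1
  refine hc (h.2.2.2.2 _ ((csSup_le h.1 hβ).trans_lt hβo) (hlt x hx).ne_bot ?_)
  rw [Set.inter_eq_left.2 (show c ⊆ Set.Iio (sSup c) from hlt)]

theorem CUCond.sSup_lt {F : Set Ordinal.{u}} {o : Ordinal.{u}} {c : Set Ordinal.{u}}
    (h : CUCond F o c) : sSup c < o :=
  h.2.2.1 h.sSup_mem

theorem CUExt.refl {c : Set Ordinal.{u}} (hb : BddAbove c) : CUExt c c :=
  .of_subset hb subset_rfl fun _ hx _ ↦ hx

theorem CUExt.sSup_le {F : Set Ordinal.{u}} {o : Ordinal.{u}} {c' c : Set Ordinal.{u}}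
    (h : CUExt c' c) (hc' : CUCond F o c') (hc : CUCond F o c) : sSup c ≤ sSup c' :=
  csSup_le_csSup hc'.bddAbove hc.1 h.subset

theorem CUExt.trans {F : Set Ordinal.{u}} {o : Ordinal.{u}} {c₁ c₂ c₃ : Set Ordinal.{u}}
    (h : CUExt c₃ c₂) (h' : CUExt c₂ c₁) (hc₂ : CUCond F o c₂) (hc₁ : CUCond F o c₁) :
    CUExt c₃ c₁ :=
  .of_subset hc₁.bddAbove (h'.subset.trans h.subset) fun _ hx hxc ↦
    h'.mem (h.mem hx (hxc.trans (h'.sSup_le hc₂ hc₁))) hxc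

/-- Adding a successor ordinal on top of a condition. -/
theorem CUCond.insert_succ {F : Set Ordinal.{u}} {o : Ordinal.{u}} {c : Set Ordinal.{u}}
    (hc : CUCond F o c) {β : Ordinal.{u}} (hβ : sSup c ≤ β) (hβo : β + 1 < o)
    (hF : β + 1 ∈ F) : CUCond F o (insert (β + 1) c) ∧ CUExt (insert (β + 1) c) c ∧
      β < sSup (insert (β + 1) c) := by
  have hle : ∀ x ∈ insert (β + 1) c, x ≤ β + 1 := by
    rintro x (rfl | hx)
    · exact le_rfl
    · exact ((le_csSup hc.bddAbove hx).trans hβ).trans (by simp)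
  refine ⟨⟨Set.insert_nonempty _ _, Set.insert_subset hF hc.2.1, Set.insert_subset hβo hc.2.2.1,
    ⟨β + 1, hβo, hle⟩, ?_⟩, .of_subset hc.bddAbove (Set.subset_insert _ _) ?_, ?_⟩
  · intro α hαo hα0 hα
    have hne : (insert (β + 1) c ∩ Set.Iio α).Nonempty := by
      by_contra hne
      rw [Set.not_nonempty_iff_eq_empty] at hne
      rw [hne] at hα
      exact hα0 (by simpa using hα.symm)
    have hαβ : α ≤ β + 1 := hα ▸ csSup_le hne fun x hx ↦ hle x hx.1
    have heq : insert (β + 1) c ∩ Set.Iio α = c ∩ Set.Iio α := by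
      ext x
      simp only [Set.mem_inter_iff, Set.mem_insert_iff, Set.mem_Iio]
      constructor
      · rintro ⟨rfl | hx, hxα⟩
        · exact absurd hαβ hxα.not_ge
        · exact ⟨hx, hxα⟩
      · exact fun h ↦ ⟨.inr h.1, h.2⟩
    rw [heq] at hα
    exact .inr (hc.2.2.2.2 α hαo hα0 hα)
  · rintro x (rfl | hx) hxc
    · exact absurd (hxc.trans hβ) (by simp)
    · exact hx
  · exact (Order.lt_add_one_iff.2 le_rfl).trans_le
      (le_csSup ⟨β + 1, hle⟩ (Set.mem_insert _ _))

theorem sSup_iUnion_of_CUCond {F : Set Ordinal.{u}} {o : Ordinal.{u}} {ι : Type u} [Nonempty ι]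
    {q : ι → Set Ordinal.{u}} (hq : ∀ k, CUCond F o (q k)) :
    BddAbove (⋃ k, q k) ∧ sSup (⋃ k, q k) = ⨆ k, sSup (q k) := by
  have hle : ∀ x ∈ ⋃ k, q k, x ≤ ⨆ k, sSup (q k) := by
    intro x hx
    obtain ⟨k, hk⟩ := Set.mem_iUnion.1 hx
    exact (le_csSup (hq k).bddAbove hk).trans (le_ciSup Ordinal.bddAbove_of_small k)
  refine ⟨⟨_, hle⟩, le_antisymm (csSup_le' hle) (ciSup_le fun k ↦ ?_)⟩
  exact le_csSup ⟨_, hle⟩ (Set.mem_iUnion.2 ⟨k, (hq k).sSup_mem⟩)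

/-- The union of a chain of conditions, closed off by its supremum, is a condition extending all
members of the chain. -/
theorem CUCond.closeUp {F : Set Ordinal.{u}} {o : Ordinal.{u}} {ι : Type u} [Nonempty ι]
    {q : ι → Set Ordinal.{u}} (hq : ∀ k, CUCond F o (q k))
    (hchain : ∀ k l, CUExt (q k) (q l) ∨ CUExt (q l) (q k))
    (ho : sSup (⋃ k, q k) < o) (hF : sSup (⋃ k, q k) ∉ ⋃ k, q k → sSup (⋃ k, q k) ∈ F) :
    CUCond F o (insert (sSup (⋃ k, q k)) (⋃ k, q k)) ∧
      ∀ k, CUExt (insert (sSup (⋃ k, q k)) (⋃ k, q k)) (q k) := by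
  have hb := (sSup_iUnion_of_CUCond hq).1
  set A := ⋃ k, q k with hA
  have hmem : ∀ k, ∀ x ∈ insert (sSup A) A, x ≤ sSup (q k) → x ∈ q k := by
    have key : ∀ k, ∀ x ∈ A, x ≤ sSup (q k) → x ∈ q k := by
      intro k x hx hxk
      obtain ⟨l, hl⟩ := Set.mem_iUnion.1 hx
      rcases hchain k l with h | h
      · exact h.subset hl
      · exact h.mem hl hxk
    rintro k x (rfl | hx) hxk
    · have : sSup (q k) ≤ sSup A := le_csSup hb (Set.mem_iUnion.2 ⟨k, (hq k).sSup_mem⟩)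
      rw [hxk.antisymm this]
      exact (hq k).sSup_mem
    · exact key k x hx hxk
  have hle : ∀ x ∈ insert (sSup A) A, x ≤ sSup A := by
    rintro x (rfl | hx)
    · exact le_rfl
    · exact le_csSup hb hx
  have hAF : A ⊆ F := Set.iUnion_subset fun k ↦ (hq k).2.1
  refine ⟨⟨Set.insert_nonempty _ _, Set.insert_subset ?_ hAF,
    fun x hx ↦ (hle x hx).trans_lt ho, ⟨_, ho, hle⟩, ?_⟩, fun k ↦ .of_subset (hq k).bddAbove
      ((Set.subset_iUnion q k).trans (Set.subset_insert _ _)) (hmem k)⟩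
  · by_cases h : sSup A ∈ A
    · exact hAF h
    · exact hF h
  · intro α hαo hα0 hα
    have hαA : α ≤ sSup A := by
      rw [← hα]
      exact csSup_le' fun x hx ↦ hle x hx.1
    rcases hαA.eq_or_lt with rfl | hαA
    · exact Set.mem_insert _ _
    have hne : A.Nonempty := (Set.nonempty_iUnion.2 ⟨Classical.arbitrary ι, (hq _).1⟩)
    obtain ⟨x, hx, hαx⟩ := exists_lt_of_lt_csSup hne hαA
    obtain ⟨k, hk⟩ := Set.mem_iUnion.1 hx
    have hαk : α < sSup (q k) := hαx.trans_le (le_csSup (hq k).bddAbove hk)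
    have heq : insert (sSup A) A ∩ Set.Iio α = q k ∩ Set.Iio α := by
      ext y
      refine ⟨fun hy ↦ ⟨hmem k y hy.1 (hy.2.le.trans hαk.le), hy.2⟩, fun hy ↦
        ⟨.inr (Set.mem_iUnion.2 ⟨k, hy.1⟩), hy.2⟩⟩
    rw [heq] at hα
    exact .inr (Set.mem_iUnion.2 ⟨k, (hq k).2.2.2.2 α hαo hα0 hα⟩)

theorem ProdExt.refl {κ δ : Cardinal.{u}} {S p : Ordinal.{u} → Set Ordinal.{u}}
    (hp : ProdCond κ δ S p) : ProdExt δ p p :=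
  fun γ hγ ↦ .refl (hp γ hγ).bddAbove

theorem ProdExt.trans {κ δ : Cardinal.{u}} {S p₁ p₂ p₃ : Ordinal.{u} → Set Ordinal.{u}}
    (h : ProdExt δ p₃ p₂) (h' : ProdExt δ p₂ p₁) (hp₂ : ProdCond κ δ S p₂)
    (hp₁ : ProdCond κ δ S p₁) : ProdExt δ p₃ p₁ :=
  fun γ hγ ↦ (h γ hγ).trans (h' γ hγ) (hp₂ γ hγ) (hp₁ γ hγ)

/-- Every condition can be extended into a dense set so that all maxima exceed a given ordinal. -/
theorem exists_prodExt_mem_dense {κ δ : Cardinal.{u}} (hκ : Cardinal.aleph0 ≤ κ)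
    {S : Ordinal.{u} → Set Ordinal.{u}}
    (hcof : ∀ γ < δ.ord, ∀ x ∈ S (1 + γ), x.cof = κ) {D : Set (Ordinal.{u} → Set Ordinal.{u})}
    (hD : ∀ p, ProdCond κ δ S p → ∃ q, ProdCond κ δ S q ∧ q ∈ D ∧ ProdExt δ q p)
    {ξ : Ordinal.{u}} (hξ : ξ < (Order.succ κ).ord) {p : Ordinal.{u} → Set Ordinal.{u}}
    (hp : ProdCond κ δ S p) :
    ∃ q, ProdCond κ δ S q ∧ q ∈ D ∧ ProdExt δ q p ∧ ∀ γ < δ.ord, ξ < sSup (q γ) := by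
  have hlim : Order.IsSuccLimit (Order.succ κ).ord :=
    Cardinal.isSuccLimit_ord (hκ.trans (Order.le_succ κ))
  have key : ∀ γ < δ.ord, _ := fun γ hγ ↦ (hp γ hγ).insert_succ (β := max ξ (sSup (p γ)))
    (le_max_right _ _) (hlim.add_one_lt (max_lt hξ (hp γ hγ).sSup_lt))
    ⟨hlim.add_one_lt (max_lt hξ (hp γ hγ).sSup_lt), fun h ↦ by
      have h1 := hcof γ hγ _ h
      rw [Ordinal.cof_add_one] at h1
      exact (Cardinal.one_lt_aleph0.trans_le hκ).ne h1⟩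
  set p' : Ordinal.{u} → Set Ordinal.{u} := fun γ ↦ insert (max ξ (sSup (p γ)) + 1) (p γ)
  have hp' : ProdCond κ δ S p' := fun γ hγ ↦ (key γ hγ).1
  obtain ⟨q, hq, hqD, hqp⟩ := hD p' hp'
  refine ⟨q, hq, hqD, hqp.trans (fun γ hγ ↦ (key γ hγ).2.1) hp' hp, fun γ hγ ↦ ?_⟩
  exact (le_max_left _ _).trans_lt
    ((key γ hγ).2.2.trans_le ((hqp γ hγ).sSup_le (hq γ hγ) (hp' γ hγ)))

/-- The coordinatewise union of a family of conditions, closed off by its suprema. -/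
noncomputable def chainBound {ι : Type u} (q : ι → Ordinal.{u} → Set Ordinal.{u}) :
    Ordinal.{u} → Set Ordinal.{u} :=
  fun γ ↦ insert (sSup (⋃ k, q k γ)) (⋃ k, q k γ)

theorem prodCond_chainBound {κ δ : Cardinal.{u}} (hκ : Cardinal.aleph0 ≤ κ)
    {S : Ordinal.{u} → Set Ordinal.{u}} {ι : Type u} [Nonempty ι] (hι : Cardinal.mk ι ≤ κ)
    {q : ι → Ordinal.{u} → Set Ordinal.{u}} (hq : ∀ k, ProdCond κ δ S (q k))
    (hchain : ∀ k l, ProdExt δ (q k) (q l) ∨ ProdExt δ (q l) (q k))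
    (htop : ∀ γ < δ.ord, sSup (⋃ k, q k γ) ∉ ⋃ k, q k γ → sSup (⋃ k, q k γ) ∉ S (1 + γ)) :
    ProdCond κ δ S (chainBound q) ∧ ∀ k, ProdExt δ (chainBound q) (q k) := by
  have key : ∀ γ < δ.ord, _ := fun γ hγ ↦ by
    have ho : sSup (⋃ k, q k γ) < (Order.succ κ).ord := by
      rw [(sSup_iUnion_of_CUCond fun k ↦ hq k γ hγ).2]
      refine Ordinal.iSup_lt_of_lt_cof ?_ fun k ↦ (hq k γ hγ).sSup_lt
      rw [(Cardinal.isRegular_succ hκ).cof_ord]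
      exact Order.lt_succ_of_le hι
    exact CUCond.closeUp (fun k ↦ hq k γ hγ)
      (fun k l ↦ (hchain k l).imp (fun h ↦ h γ hγ) fun h ↦ h γ hγ) ho
      fun h ↦ ⟨ho, htop γ hγ h⟩
  exact ⟨fun γ hγ ↦ (key γ hγ).1, fun k γ hγ ↦ (key γ hγ).2 k⟩

theorem cof_sSup_iUnion_ne {κ : Cardinal.{u}} {F : Set Ordinal.{u}} {o : Ordinal.{u}}
    {ι : Type u} [Nonempty ι] (hι : Cardinal.mk ι < κ) {q : ι → Set Ordinal.{u}}
    (hq : ∀ k, CUCond F o (q k)) (h : sSup (⋃ k, q k) ∉ ⋃ k, q k) :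
    (sSup (⋃ k, q k)).cof ≠ κ := by
  rintro rfl
  obtain ⟨hb, hs⟩ := sSup_iUnion_of_CUCond hq
  refine (Ordinal.iSup_lt_of_lt_cof hι fun k ↦ ?_).ne hs.symm
  have hk : sSup (q k) ∈ ⋃ k, q k := Set.mem_iUnion.2 ⟨k, (hq k).sSup_mem⟩
  exact (le_csSup hb hk).lt_of_ne fun he ↦ h (he ▸ hk)

/-- The recursively built sequence of conditions below `p`: at stage `i`, close off the previous
stages and apply the strategy `E i (s i)`. -/
noncomputable def fusion
    (E : Ordinal.{u} → Ordinal.{u} → (Ordinal.{u} → Set Ordinal.{u}) → Ordinal.{u} → Set Ordinal.{u})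
    (p : Ordinal.{u} → Set Ordinal.{u}) (s : Ordinal.{u} → Ordinal.{u}) (i : Ordinal.{u}) :
    Ordinal.{u} → Set Ordinal.{u} :=
  E i (s i) (chainBound fun k : Option i.ToType ↦ k.elim p fun j ↦ fusion E p s j.toOrd)
termination_by i
decreasing_by exact j.toOrd.2

theorem fusion_congr
    (E : Ordinal.{u} → Ordinal.{u} → (Ordinal.{u} → Set Ordinal.{u}) → Ordinal.{u} → Set Ordinal.{u})
    (p : Ordinal.{u} → Set Ordinal.{u}) {s t : Ordinal.{u} → Ordinal.{u}} (i : Ordinal.{u})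
    (h : ∀ j ≤ i, s j = t j) : fusion E p s i = fusion E p t i := by
  induction i using WellFoundedLT.induction with
  | _ i ih =>
    rw [fusion, fusion, h i le_rfl]
    congr 2
    funext k
    cases k with
    | none => rfl
    | some j => exact ih _ j.toOrd.2 fun l hl ↦ h l (hl.trans j.toOrd.2.le)

/-- What a stage of the construction `fusion` is required to satisfy. -/
structure FusionStage (κ δ : Cardinal.{u}) (S : Ordinal.{u} → Set Ordinal.{u})
    (Ds : Ordinal.{u} → Set (Ordinal.{u} → Set Ordinal.{u}))
    (E : Ordinal.{u} → Ordinal.{u} → (Ordinal.{u} → Set Ordinal.{u}) → Ordinal.{u} → Set Ordinal.{u})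
    (p : Ordinal.{u} → Set Ordinal.{u}) (s : Ordinal.{u} → Ordinal.{u}) (i : Ordinal.{u}) :
    Prop where
  prodCond : ProdCond κ δ S (fusion E p s i)
  mem : fusion E p s i ∈ Ds i
  lt_sSup : ∀ γ < δ.ord, s i < sSup (fusion E p s i γ)
  prodExt_base : ProdExt δ (fusion E p s i) p
  prodExt : ∀ j < i, ProdExt δ (fusion E p s i) (fusion E p s j)

section

variable {κ δ : Cardinal.{u}} {S : Ordinal.{u} → Set Ordinal.{u}}
  {Ds : Ordinal.{u} → Set (Ordinal.{u} → Set Ordinal.{u})}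
  {E : Ordinal.{u} → Ordinal.{u} → (Ordinal.{u} → Set Ordinal.{u}) → Ordinal.{u} → Set Ordinal.{u}}
  {p : Ordinal.{u} → Set Ordinal.{u}} {s : Ordinal.{u} → Ordinal.{u}}

theorem prodCond_fusion_family (hp : ProdCond κ δ S p) {i : Ordinal.{u}}
    (h : ∀ j < i, FusionStage κ δ S Ds E p s j) (k : Option i.ToType) :
    ProdCond κ δ S (k.elim p fun j ↦ fusion E p s j.toOrd) := by
  cases k with
  | none => exact hp
  | some j => exact (h _ j.toOrd.2).prodCond

theorem prodExt_fusion_family (hp : ProdCond κ δ S p) {i : Ordinal.{u}}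
    (h : ∀ j < i, FusionStage κ δ S Ds E p s j) (k l : Option i.ToType) :
    ProdExt δ (k.elim p fun j ↦ fusion E p s j.toOrd) (l.elim p fun j ↦ fusion E p s j.toOrd) ∨
    ProdExt δ (l.elim p fun j ↦ fusion E p s j.toOrd)
      (k.elim p fun j ↦ fusion E p s j.toOrd) := by
  cases k with
  | none =>
    cases l with
    | none => exact .inl (.refl hp)
    | some j => exact .inr (h _ j.toOrd.2).prodExt_base
  | some j =>
    cases l with
    | none => exact .inl (h _ j.toOrd.2).prodExt_base
    | some l =>
      rcases lt_trichotomy j.toOrd.1 l.toOrd.1 with hjl | hjl | hjl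
      · exact .inr ((h _ l.toOrd.2).prodExt _ hjl)
      · simp only [Option.elim, hjl]
        exact .inl (.refl (h _ l.toOrd.2).prodCond)
      · exact .inl ((h _ j.toOrd.2).prodExt _ hjl)

theorem fusionStage (hκ : Cardinal.aleph0 ≤ κ)
    (hcof : ∀ γ < δ.ord, ∀ x ∈ S (1 + γ), x.cof = κ)
    (hE : ∀ i < κ.ord, ∀ ξ < (Order.succ κ).ord, ∀ q, ProdCond κ δ S q →
      ProdCond κ δ S (E i ξ q) ∧ E i ξ q ∈ Ds i ∧ ProdExt δ (E i ξ q) q ∧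
        ∀ γ < δ.ord, ξ < sSup (E i ξ q γ))
    (hp : ProdCond κ δ S p) (hs : ∀ j, s j < (Order.succ κ).ord) {i : Ordinal.{u}}
    (hi : i < κ.ord) : FusionStage κ δ S Ds E p s i := by
  induction i using WellFoundedLT.induction with
  | _ i ih =>
    replace ih : ∀ j < i, FusionStage κ δ S Ds E p s j := fun j hj ↦ ih j hj (hj.trans hi)
    have hcard : Cardinal.mk (Option i.ToType) < κ := by
      rw [Cardinal.mk_option, Cardinal.mk_toType]
      exact Cardinal.add_lt_of_lt hκ (Cardinal.lt_ord.1 hi) (Cardinal.one_lt_aleph0.trans_le hκ)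
    have hq := prodCond_fusion_family hp ih
    obtain ⟨hL, hLext⟩ := prodCond_chainBound hκ hcard.le hq (prodExt_fusion_family hp ih)
      fun γ hγ h hS ↦ cof_sSup_iUnion_ne hcard (fun k ↦ hq k γ hγ) h (hcof γ hγ _ hS)
    have hEi := hE i hi (s i) (hs i) _ hL
    have heq : fusion E p s i = E i (s i)
        (chainBound fun k : Option i.ToType ↦ k.elim p fun j ↦ fusion E p s j.toOrd) := by
      rw [fusion]
    rw [← heq] at hEi
    obtain ⟨h1, h2, h3, h4⟩ := hEi
    refine ⟨h1, h2, h4, h3.trans (hLext none) hL hp, fun j hj ↦ h3.trans ?_ hL (ih j hj).prodCond⟩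
    simpa using hLext (some (Ordinal.ToType.mk ⟨j, hj⟩))

end

/-- Bounded increasing set-valued functions have clubs of closure points. -/
theorem isClubIn_closurePoints {o : Ordinal.{u}} (ho : Cardinal.aleph0 < o.cof)
    {T : Ordinal.{u} → Set Ordinal.{u}} (hT : Monotone T)
    (hb : ∀ β < o, ∃ b < o, ∀ x ∈ T β, x < b) :
    IsClubIn {α | α < o ∧ ∀ β < α, ∀ x ∈ T β, x < α} o := by
  refine ⟨fun α hα ↦ hα.1, fun α hαo hα0 hα ↦ ⟨hαo, fun β hβ x hx ↦ ?_⟩, fun α hα ↦ ?_⟩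
  · have hne : ({α | α < o ∧ ∀ β < α, ∀ x ∈ T β, x < α} ∩ Set.Iio α).Nonempty := by
      by_contra hne
      rw [Set.not_nonempty_iff_eq_empty] at hne
      rw [hne] at hα
      exact hα0 (by simpa using hα.symm)
    obtain ⟨c, hc, hβc⟩ := exists_lt_of_lt_csSup hne (hα.symm ▸ hβ)
    exact (hc.1.2 β hβc x hx).trans hc.2
  · choose! b hbo hb using hb
    have hlim : Order.IsSuccLimit o := Ordinal.one_lt_cof_iff.1 (Cardinal.one_lt_aleph0.trans ho)
    let f : Ordinal.{u} → Ordinal.{u} := fun x ↦ max x (b x) + 1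
    have hf : ∀ x < o, f x < o := fun x hx ↦ hlim.add_one_lt (max_lt hx (hbo x hx))
    have hit : ∀ n, f^[n] α < o := fun n ↦ by
      induction n with
      | zero => exact hα
      | succ n ih => rw [Function.iterate_succ_apply']; exact hf _ ih
    have hlt : ∀ x, max x (b x) < f x := fun x ↦ Order.lt_add_one_iff.2 le_rfl
    refine ⟨Ordinal.nfp f α, ⟨Ordinal.nfp_lt_ord ho hf hα, fun β hβ x hx ↦ ?_⟩, ?_⟩
    · obtain ⟨n, hn⟩ := Ordinal.lt_nfp_iff.1 hβ
      refine Ordinal.lt_nfp_iff.2 ⟨n + 1, ?_⟩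
      rw [Function.iterate_succ_apply']
      exact (hb _ (hit n) x (hT hn.le hx)).trans_le ((le_max_right _ _).trans (hlt _).le)
    · exact ((le_max_left _ _).trans_lt (hlt α)).trans_le (Ordinal.iterate_le_nfp f α 1)

theorem toOrd_mk {o j : Ordinal.{u}} (h : j < o) :
    (Ordinal.ToType.mk ⟨j, Set.mem_Iio.2 h⟩ : o.ToType).toOrd.1 = j :=
  congrArg Subtype.val (Ordinal.ToType.mk.symm_apply_apply _)

/-- An ordinal of cofinality `κ` is the supremum of a sequence indexed by `κ`. -/
theorem exists_cofinal_sequence {α : Ordinal.{u}} {κ : Cardinal.{u}} (hα : α.cof = κ)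
    (hα0 : 0 < α) :
    ∃ s : Ordinal.{u} → Ordinal.{u}, (∀ j, s j < α) ∧ ∀ β < α, ∃ i < κ.ord, β ≤ s i := by
  obtain ⟨t, ht, htκ⟩ := Order.exists_cof_eq α.ToType
  rw [Ordinal.cof_toType, hα, ← Cardinal.mk_ord_toType κ] at htκ
  obtain ⟨e⟩ := Cardinal.eq.1 htκ
  classical
  refine ⟨fun j ↦ if h : j < κ.ord then (e.symm (Ordinal.ToType.mk ⟨j, h⟩)).1.toOrd else 0,
    fun j ↦ ?_, fun β hβ ↦ ?_⟩
  · dsimp only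
    split_ifs with h
    · exact (Ordinal.ToType.toOrd _).2
    · exact hα0
  · obtain ⟨y, hy, hle⟩ := ht (Ordinal.ToType.mk ⟨β, hβ⟩)
    refine ⟨(e ⟨y, hy⟩).toOrd, (e ⟨y, hy⟩).toOrd.2, ?_⟩
    have hy' : Ordinal.ToType.mk ⟨(e ⟨y, hy⟩).toOrd.1, (e ⟨y, hy⟩).toOrd.2⟩ = e ⟨y, hy⟩ :=
      Ordinal.ToType.mk.apply_symm_apply _
    have h : (⟨β, hβ⟩ : Set.Iio α) ≤ y.toOrd := by
      simpa using Ordinal.ToType.mk.symm.monotone hle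
    have hmem : (e ⟨y, hy⟩).toOrd.1 < κ.ord := (e ⟨y, hy⟩).toOrd.2
    refine le_of_le_of_eq (b := (y.toOrd : Ordinal)) h ?_
    refine Eq.trans ?_ (dif_pos hmem).symm
    rw [hy', Equiv.symm_apply_apply]

/-- There are few bounded sequences of length less than `κ`, so the maxima occurring along them are
bounded below `κ⁺`. -/
theorem exists_bound_fusion {κ δ : Cardinal.{u}} {S : Ordinal.{u} → Set Ordinal.{u}}
    {Ds : Ordinal.{u} → Set (Ordinal.{u} → Set Ordinal.{u})}
    {E : Ordinal.{u} → Ordinal.{u} → (Ordinal.{u} → Set Ordinal.{u}) → Ordinal.{u} → Set Ordinal.{u}}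
    {p : Ordinal.{u} → Set Ordinal.{u}} (hκ : Cardinal.aleph0 ≤ κ)
    (hpow : Cardinal.powerlt κ κ = κ) (hδκ : δ ≤ κ)
    (hstage : ∀ s : Ordinal.{u} → Ordinal.{u}, (∀ j, s j < (Order.succ κ).ord) →
      ∀ i < κ.ord, FusionStage κ δ S Ds E p s i)
    {β : Ordinal.{u}} (hβ : β < (Order.succ κ).ord) :
    ∃ b < (Order.succ κ).ord, ∀ i < κ.ord, ∀ s : Ordinal.{u} → Ordinal.{u}, (∀ j, s j < β) →
      ∀ γ < δ.ord, sSup (fusion E p s i γ) < b := by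
  classical
  have ho : 0 < (Order.succ κ).ord := (zero_le (a := β)).trans_lt hβ
  let ext : ∀ {i : Ordinal.{u}}, (i.ToType → β.ToType) → Ordinal.{u} → Ordinal.{u} :=
    fun {i} f j ↦ if h : j < i then (f (Ordinal.ToType.mk ⟨j, h⟩)).toOrd else 0
  have hext : ∀ {i : Ordinal.{u}} (f : i.ToType → β.ToType) (j : Ordinal.{u}),
      ext f j < (Order.succ κ).ord := by
    intro i f j
    dsimp only [ext]
    split_ifs with h
    · exact lt_trans (Ordinal.ToType.toOrd _).2 hβ
    · exact ho
  let ι : Type u :=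
    Σ i : κ.ord.ToType, ((Order.succ i.toOrd.1).ToType → β.ToType) × δ.ord.ToType
  let g : ι → Ordinal.{u} := fun k ↦ sSup (fusion E p (ext k.2.1) k.1.toOrd k.2.2.toOrd)
  have hκlim : Order.IsSuccLimit κ.ord := Cardinal.isSuccLimit_ord hκ
  have hι : Cardinal.mk ι ≤ κ := by
    have hle : ∀ i : κ.ord.ToType, Cardinal.mk
        (((Order.succ i.toOrd.1).ToType → β.ToType) × δ.ord.ToType) ≤ κ := by
      intro i
      have h1 : (Order.succ i.toOrd.1).card < κ :=
        Cardinal.lt_ord.1 (hκlim.succ_lt i.toOrd.2)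
      have h2 : β.card ≤ κ := Order.lt_succ_iff.1 (Cardinal.lt_ord.1 hβ)
      rw [Cardinal.mk_prod, Cardinal.lift_id, Cardinal.lift_id, ← Cardinal.power_def,
        Cardinal.mk_toType, Cardinal.mk_toType, Cardinal.mk_ord_toType]
      refine (mul_le_mul' ?_ hδκ).trans (Cardinal.mul_eq_self hκ).le
      exact (Cardinal.power_le_power_right h2).trans ((Cardinal.le_powerlt κ h1).trans hpow.le)
    rw [Cardinal.mk_sigma]
    refine (Cardinal.sum_le_sum _ (fun _ ↦ κ) hle).trans ?_
    rw [Cardinal.sum_const', Cardinal.mk_ord_toType, Cardinal.mul_eq_self hκ]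
  have hg : ⨆ k, g k + 1 < (Order.succ κ).ord := by
    refine Ordinal.iSup_add_one_lt_of_lt_cof ?_ fun k ↦ ?_
    · rw [(Cardinal.isRegular_succ hκ).cof_ord]
      exact Order.lt_succ_of_le hι
    · exact ((hstage _ (hext _) _ k.1.toOrd.2).prodCond _ k.2.2.toOrd.2).sSup_lt
  refine ⟨_, hg, fun i hi s hs γ hγ ↦ ?_⟩
  have hi' : (Ordinal.ToType.mk ⟨i, hi⟩).toOrd.1 = i := toOrd_mk hi
  have hγ' : (Ordinal.ToType.mk ⟨γ, hγ⟩).toOrd.1 = γ := toOrd_mk hγ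
  let f : (Order.succ (Ordinal.ToType.mk ⟨i, hi⟩).toOrd.1).ToType → β.ToType :=
    fun j ↦ Ordinal.ToType.mk ⟨s j.toOrd, hs _⟩
  have heq : fusion E p s i = fusion E p (ext f) i := by
    refine fusion_congr E p i fun j hj ↦ ?_
    have hj' : j < Order.succ (Ordinal.ToType.mk ⟨i, hi⟩).toOrd.1 := by
      rw [hi']
      exact Order.lt_succ_of_le hj
    simp only [ext, f]
    rw [dif_pos hj']
    simp
  let k : ι := ⟨Ordinal.ToType.mk ⟨i, hi⟩, f, Ordinal.ToType.mk ⟨γ, hγ⟩⟩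
  have hk : g k = sSup (fusion E p s i γ) := by
    rw [heq]
    exact congrArg₂ (fun a b ↦ sSup (fusion E p (ext f) a b)) hi' hγ'
  rw [← hk]
  exact (Order.lt_add_one_iff.2 le_rfl).trans_le
    (le_ciSup (f := fun k ↦ g k + 1) Ordinal.bddAbove_of_small k)

/-- the full product `∏_{γ<δ} CU(κ⁺ \ S_{1+γ})` is `κ`-distributive: the
intersection of at most `κ` many dense open subsets is dense open. -/
theorem stmt15
    (κ : Cardinal.{u}) (hκ : Cardinal.aleph0 ≤ κ)
    (hpow : Cardinal.powerlt κ κ = κ)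
    (δ : Cardinal.{u}) (hδ : δ.IsRegular) (hδκ : δ ≤ κ)
    (S : Ordinal.{u} → Set Ordinal.{u})
    (hSsub : ∀ γ < δ.ord, S γ ⊆
      {α : Ordinal.{u} | α < (Order.succ κ).ord ∧ α.cof = κ})
    (hSstat : ∀ γ < δ.ord, IsStationaryIn (S γ) (Order.succ κ).ord)
    (hSdisj : ∀ γ < δ.ord, ∀ γ' < δ.ord, γ ≠ γ' → Disjoint (S γ) (S γ')) :
    ∀ Ds : Ordinal.{u} → Set (Ordinal.{u} → Set Ordinal.{u}),
      (∀ i < κ.ord,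
        (∀ p, ProdCond κ δ S p → ∃ q, ProdCond κ δ S q ∧ q ∈ Ds i ∧ ProdExt δ q p) ∧
        (∀ q ∈ Ds i, ProdCond κ δ S q →
          ∀ q', ProdCond κ δ S q' → ProdExt δ q' q → q' ∈ Ds i)) →
      ((∀ p, ProdCond κ δ S p →
          ∃ q, ProdCond κ δ S q ∧ (∀ i < κ.ord, q ∈ Ds i) ∧ ProdExt δ q p) ∧
       (∀ q, ProdCond κ δ S q → (∀ i < κ.ord, q ∈ Ds i) →
          ∀ q', ProdCond κ δ S q' → ProdExt δ q' q → ∀ i < κ.ord, q' ∈ Ds i)) := by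
  have h1γ : ∀ γ < δ.ord, 1 + γ < δ.ord := fun γ hγ ↦ by
    rw [Cardinal.lt_ord, Ordinal.card_add, Ordinal.card_one]
    exact Cardinal.add_lt_of_lt hδ.aleph0_le (Cardinal.one_lt_aleph0.trans_le hδ.aleph0_le)
      (Cardinal.lt_ord.1 hγ)
  have hδ0 : 0 < δ.ord := hδ.ord_pos
  have hcof : ∀ γ < δ.ord, ∀ x ∈ S (1 + γ), x.cof = κ := fun γ hγ x hx ↦
    (hSsub _ (h1γ γ hγ) hx).2
  intro Ds hDs
  refine ⟨fun p hp ↦ ?_, fun q hq hqD q' hq' hext i hi ↦ (hDs i hi).2 q (hqD i hi) hq q' hq' hext⟩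
  have hE : ∀ (i ξ : Ordinal.{u}) (q : Ordinal.{u} → Set Ordinal.{u}), ∃ r, i < κ.ord →
      ξ < (Order.succ κ).ord → ProdCond κ δ S q → ProdCond κ δ S r ∧ r ∈ Ds i ∧
        ProdExt δ r q ∧ ∀ γ < δ.ord, ξ < sSup (r γ) := by
    intro i ξ q
    by_cases h : i < κ.ord ∧ ξ < (Order.succ κ).ord ∧ ProdCond κ δ S q
    · obtain ⟨r, hr⟩ := exists_prodExt_mem_dense hκ hcof (hDs i h.1).1 h.2.1 h.2.2
      exact ⟨r, fun _ _ _ ↦ hr⟩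
    · exact ⟨q, fun h1 h2 h3 ↦ absurd ⟨h1, h2, h3⟩ h⟩
  choose E hE using hE
  have hstage : ∀ s : Ordinal.{u} → Ordinal.{u}, (∀ j, s j < (Order.succ κ).ord) →
      ∀ i < κ.ord, FusionStage κ δ S Ds E p s i := fun s hs i hi ↦
    fusionStage hκ hcof (fun i hi ξ hξ q hq ↦ hE i ξ q hi hξ hq) hp hs hi
  have hclub := isClubIn_closurePoints (o := (Order.succ κ).ord)
    (T := fun β ↦ {x | ∃ i < κ.ord, ∃ s : Ordinal.{u} → Ordinal.{u}, (∀ j, s j < β) ∧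
      ∃ γ < δ.ord, x = sSup (fusion E p s i γ)})
    (by
      rw [(Cardinal.isRegular_succ hκ).cof_ord]
      exact Order.lt_succ_of_le hκ)
    (fun a b hab x ⟨i, hi, s, hs, h⟩ ↦ ⟨i, hi, s, fun j ↦ (hs j).trans_le hab, h⟩)
    (fun β hβ ↦ by
      obtain ⟨b, hb, h⟩ := exists_bound_fusion hκ hpow hδκ hstage hβ
      refine ⟨b, hb, ?_⟩
      rintro x ⟨i, hi, s, hs, γ, hγ, rfl⟩
      exact h i hi s hs γ hγ)
  obtain ⟨α, hαS, hαo, hα⟩ := (hSstat 0 hδ0).2 _ hclub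
  have hακ : α.cof = κ := (hSsub 0 hδ0 hαS).2
  have hαlim : Order.IsSuccLimit α := Ordinal.one_lt_cof_iff.1
    (hακ ▸ Cardinal.one_lt_aleph0.trans_le hκ)
  obtain ⟨s, hsα, hscof⟩ := exists_cofinal_sequence hακ hαlim.bot_lt
  have hst := hstage s fun j ↦ (hsα j).trans hαo
  have hlt : ∀ i < κ.ord, ∀ γ < δ.ord, sSup (fusion E p s i γ) < α := by
    intro i hi γ hγ
    classical
    have hb : ⨆ j : (Order.succ i).ToType, s j.toOrd + 1 < α := by
      refine Ordinal.iSup_add_one_lt_of_lt_cof ?_ fun j ↦ hsα _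
      rw [hακ, Cardinal.mk_toType]
      exact Cardinal.lt_ord.1 ((Cardinal.isSuccLimit_ord hκ).succ_lt hi)
    set b := ⨆ j : (Order.succ i).ToType, s j.toOrd + 1
    have hsb : ∀ j ≤ i, s j < b := by
      intro j hj
      have h := le_ciSup (f := fun j : (Order.succ i).ToType ↦ s j.toOrd + 1)
        Ordinal.bddAbove_of_small (Ordinal.ToType.mk ⟨j, Order.lt_succ_of_le hj⟩)
      rw [toOrd_mk (Order.lt_succ_of_le hj)] at h
      exact (Order.lt_add_one_iff.2 le_rfl).trans_le h
    rw [fusion_congr E p (t := fun j ↦ if j ≤ i then s j else 0) i fun j hj ↦ (if_pos hj).symm]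
    refine hα b hb _ ⟨i, hi, _, fun j ↦ ?_, γ, hγ, rfl⟩
    split_ifs with hj
    · exact hsb j hj
    · exact zero_le.trans_lt (hsb i le_rfl)
  have hfam := prodCond_fusion_family hp hst
  have hcard : Cardinal.mk (Option κ.ord.ToType) ≤ κ := by
    rw [Cardinal.mk_option, Cardinal.mk_ord_toType, Cardinal.add_one_eq hκ]
  obtain ⟨hq, hqext⟩ := prodCond_chainBound hκ hcard hfam (prodExt_fusion_family hp hst)
    fun γ hγ _ hS ↦ by
      have hsup : sSup (⋃ k : Option κ.ord.ToType,
          k.elim p (fun j ↦ fusion E p s j.toOrd) γ) = α := by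
        rw [(sSup_iUnion_of_CUCond fun k ↦ hfam k γ hγ).2]
        refine le_antisymm (ciSup_le fun k ↦ ?_) (le_of_forall_lt fun β hβ ↦ ?_)
        · cases k with
          | none =>
            have h0 : 0 < κ.ord := (Cardinal.isSuccLimit_ord hκ).bot_lt
            exact (((hst 0 h0).prodExt_base γ hγ).sSup_le ((hst 0 h0).prodCond γ hγ)
              (hp γ hγ)).trans (hlt 0 h0 γ hγ).le
          | some j => exact (hlt _ j.toOrd.2 γ hγ).le
        · obtain ⟨i, hi, hβi⟩ := hscof β hβ
          have h := le_ciSup (f := fun k : Option κ.ord.ToType ↦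
            sSup (k.elim p (fun j ↦ fusion E p s j.toOrd) γ)) Ordinal.bddAbove_of_small
            (some (Ordinal.ToType.mk ⟨i, hi⟩))
          change sSup (fusion E p s (Ordinal.ToType.mk ⟨i, hi⟩).toOrd γ) ≤ _ at h
          rw [toOrd_mk hi] at h
          exact hβi.trans_lt (((hst i hi).lt_sSup γ hγ).trans_le h)
      rw [hsup] at hS
      have hne : (0 : Ordinal.{u}) ≠ 1 + γ := by
        intro h
        have : (1 : Ordinal.{u}) ≤ 1 + γ := le_self_add
        rw [← h] at this
        exact absurd this (by simp)
      exact Set.disjoint_left.1 (hSdisj 0 hδ0 _ (h1γ γ hγ) hne) hαS hS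
  refine ⟨_, hq, fun i hi ↦ (hDs i hi).2 _ (hst i hi).mem (hst i hi).prodCond _ hq ?_, hqext none⟩
  simpa using hqext (some (Ordinal.ToType.mk ⟨i, hi⟩))
end

section
/- Suppose κ is an infinite cardinal with κ^{<κ} = κ, δ ≤ κ is an infinite regular cardinal, and ⟨S_γ : γ < δ⟩ is a sequence of pairwise disjoint stationary subsets of E^{κ⁺}_κ. Let P := ∏_{γ<δ} CU(κ⁺ \ S_{1+γ}) be the full product poset (ordered coordinatewise, with 1+γ denoting ordinal addition). Then for every stationary set T ⊆ E^{κ⁺}_κ \ ⋃_{γ<δ} S_{1+γ}, every sequence ⟨D_i : i < κ⟩ of dense open subsets of P, and every condition c⃗ ∈ P, there exist θ ∈ T and an extension c⃗' of c⃗ such that c⃗' ∈ ⋂_{i<κ} D_i and max(c⃗'(γ)) = θ for every γ < δ. -/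
universe u

open Set Cardinal

theorem Set.bddAbove_of_subset_Iio {c : Set Ordinal.{u}} {o : Ordinal.{u}} (h : c ⊆ Iio o) :
    BddAbove c :=
  ⟨o, fun _ hx ↦ (h hx).le⟩

namespace CUCond

variable {F : Set Ordinal.{u}} {o : Ordinal.{u}} {c : Set Ordinal.{u}}

theorem bddAbove_s16 (h : CUCond F o c) : BddAbove c :=
  bddAbove_of_subset_Iio h.2.2.1

theorem sSup_lt_s16 (h : CUCond F o c) : sSup c < o := by
  obtain ⟨β, hβ, hc⟩ := h.2.2.2.1
  exact (csSup_le h.1 hc).trans_lt hβ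

theorem sSup_mem_s16 (h : CUCond F o c) : sSup c ∈ c := by
  by_contra hn
  have hlt : ∀ x ∈ c, x < sSup c := fun x hx ↦
    (le_csSup h.bddAbove_s16 hx).lt_of_ne fun e ↦ hn (e ▸ hx)
  have h0 : sSup c ≠ 0 := by
    intro h0
    obtain ⟨x, hx⟩ := h.1
    simpa [h0] using hlt x hx
  refine hn (h.2.2.2.2 _ h.sSup_lt_s16 h0 ?_)
  rw [show c ∩ Iio (sSup c) = c from inter_eq_left.2 hlt]

end CUCond

namespace CUExt

variable {a b c : Set Ordinal.{u}}

theorem subset_s16 (h : CUExt a b) : b ⊆ a := by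
  rw [← h]
  exact inter_subset_left

theorem refl_of_bddAbove (h : BddAbove a) : CUExt a a :=
  inter_eq_left.2 fun _ hx ↦ le_csSup h hx

theorem trans_of_nonempty (hab : CUExt a b) (hbc : CUExt b c) (hb : BddAbove b)
    (hc : c.Nonempty) : CUExt a c := by
  have hle : sSup c ≤ sSup b := csSup_le_csSup hb hc hbc.subset_s16
  calc a ∩ Iic (sSup c) = a ∩ Iic (sSup b) ∩ Iic (sSup c) := by
        rw [inter_assoc, inter_eq_right.2 (Iic_subset_Iic.2 hle)]
    _ = c := by rw [hab, hbc]

end CUExt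

/-- The union of a family of sets of ordinals together with the supremum of that union. -/
noncomputable def topUnion (A : Set (Set Ordinal.{u})) : Set Ordinal.{u} :=
  insert (sSup (⋃₀ A)) (⋃₀ A)

theorem sSup_topUnion {A : Set (Set Ordinal.{u})} (hb : BddAbove (⋃₀ A)) :
    sSup (topUnion A) = sSup (⋃₀ A) := by
  refine IsGreatest.csSup_eq ⟨mem_insert _ _, ?_⟩
  rintro x (rfl | hx)
  · exact le_rfl
  · exact le_csSup hb hx

theorem CUExt.topUnion {A : Set (Set Ordinal.{u})} (hA : ∀ c ∈ A, sSup c ∈ c)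
    (hb : BddAbove (⋃₀ A)) (hch : ∀ c ∈ A, ∀ d ∈ A, CUExt c d ∨ CUExt d c) {c : Set Ordinal.{u}}
    (hc : c ∈ A) : CUExt (topUnion A) c := by
  have hbc : BddAbove c := hb.mono (subset_sUnion_of_mem hc)
  have key : ∀ x ∈ ⋃₀ A, x ≤ sSup c → x ∈ c := by
    rintro x ⟨d, hd, hx⟩ hxc
    rcases hch c hc d hd with h | h
    · exact h.subset_s16 hx
    · rw [← h]
      exact ⟨hx, hxc⟩
  apply Subset.antisymm
  · rintro x ⟨rfl | hx, hxc⟩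
    · have : sSup (⋃₀ A) = sSup c :=
        le_antisymm hxc (le_csSup hb ⟨c, hc, hA c hc⟩)
      rw [this]
      exact hA c hc
    · exact key x hx hxc
  · exact fun x hx ↦ ⟨Or.inr ⟨c, hc, hx⟩, le_csSup hbc hx⟩

theorem CUCond.topUnion {F : Set Ordinal.{u}} {o : Ordinal.{u}} {A : Set (Set Ordinal.{u})}
    (hA : ∀ c ∈ A, CUCond F o c)
    (hch : ∀ c ∈ A, ∀ d ∈ A, CUExt c d ∨ CUExt d c)
    (ho : sSup (⋃₀ A) < o) (hF : sSup (⋃₀ A) ∈ F) : CUCond F o (topUnion A) := by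
  have hb : BddAbove (⋃₀ A) := bddAbove_of_subset_Iio (o := o) <| by
    rintro x ⟨c, hc, hx⟩
    exact (hA c hc).2.2.1 hx
  have hle : ∀ x ∈ _root_.topUnion A, x ≤ sSup (⋃₀ A) := fun x hx ↦ by
    rw [← sSup_topUnion hb]
    exact le_csSup ⟨sSup (⋃₀ A), by
      rintro y (rfl | hy)
      exacts [le_rfl, le_csSup hb hy]⟩ hx
  refine ⟨⟨_, mem_insert _ _⟩, ?_, fun x hx ↦ (hle x hx).trans_lt ho, ⟨_, ho, hle⟩, ?_⟩
  · rintro x (rfl | ⟨c, hc, hx⟩)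
    exacts [hF, (hA c hc).2.1 hx]
  · intro α hα h0 hs
    rcases lt_trichotomy α (sSup (⋃₀ A)) with hlt | rfl | hgt
    · obtain ⟨x, ⟨c, hc, hx⟩, hαx⟩ := exists_lt_of_lt_csSup' hlt
      have hext := CUExt.topUnion (fun c hc ↦ (hA c hc).sSup_mem_s16) hb hch hc
      have hαc : α ≤ sSup c := hαx.le.trans (le_csSup (hA c hc).bddAbove_s16 hx)
      have hsub : Iio α ⊆ Iic (sSup c) := fun y hy ↦ (mem_Iio.1 hy).le.trans hαc
      have hres : c ∩ Iio α = _root_.topUnion A ∩ Iio α := by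
        conv_lhs => rw [← hext]
        rw [inter_assoc, inter_eq_right.2 hsub]
      exact hext.subset_s16 ((hA c hc).2.2.2.2 α hα h0 (hres ▸ hs))
    · exact mem_insert _ _
    · refine absurd (hs ▸ hgt) (not_lt.2 ?_)
      exact csSup_le' fun y hy ↦ hle y hy.1

/-- A condition of `CU(F)` can be extended by any larger point of `F`. -/
theorem CUCond.insert_of_lt {F : Set Ordinal.{u}} {o : Ordinal.{u}} {c : Set Ordinal.{u}}
    (hc : CUCond F o c) {x : Ordinal.{u}} (hx : sSup c < x) (hxo : x < o) (hxF : x ∈ F) :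
    CUCond F o (insert x c) ∧ CUExt (insert x c) c := by
  have hle : ∀ y ∈ c, y ≤ sSup c := fun y hy ↦ le_csSup hc.bddAbove_s16 hy
  refine ⟨⟨insert_nonempty _ _, insert_subset hxF hc.2.1, insert_subset hxo hc.2.2.1,
    ⟨x, hxo, insert_subset self_mem_Iic fun y hy ↦ (hle y hy).trans hx.le⟩, ?_⟩, ?_⟩
  · intro α hα h0 hs
    rcases lt_trichotomy α x with h | rfl | h
    · refine Or.inr (hc.2.2.2.2 α hα h0 ?_)
      rwa [insert_inter_of_notMem (by simpa using h.le)] at hs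
    · exact mem_insert _ _
    · refine absurd (hs ▸ h) (not_lt.2 (csSup_le' ?_))
      rintro y ⟨rfl | hy, -⟩
      exacts [le_rfl, (hle y hy).trans hx.le]
  · rw [CUExt, insert_inter_of_notMem (by simpa using hx)]
    exact inter_eq_left.2 hle

section ProdCond

variable {κ δ : Cardinal.{u}} {S : Ordinal.{u} → Set Ordinal.{u}}
  {p q r : Ordinal.{u} → Set Ordinal.{u}}

theorem ProdCond.ext_refl (hp : ProdCond κ δ S p) : ProdExt δ p p :=
  fun γ hγ ↦ .refl_of_bddAbove (hp γ hγ).bddAbove_s16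

theorem ProdExt.trans_of_prodCond (hqr : ProdExt δ q r) (hrp : ProdExt δ r p)
    (hr : ProdCond κ δ S r) (hp : ProdCond κ δ S p) : ProdExt δ q p :=
  fun γ hγ ↦ (hqr γ hγ).trans_of_nonempty (hrp γ hγ) (hr γ hγ).bddAbove_s16 (hp γ hγ).1

theorem ProdExt.sSup_le (h : ProdExt δ q p) (hq : ProdCond κ δ S q) (hp : ProdCond κ δ S p)
    {γ : Ordinal.{u}} (hγ : γ < δ.ord) : sSup (p γ) ≤ sSup (q γ) :=
  csSup_le_csSup (hq γ hγ).bddAbove_s16 (hp γ hγ).1 (h γ hγ).subset_s16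

end ProdCond

/-- The sequence of conditions starting at `p`, guided by the sequence of ordinals `t`:
the step from stage `j` to stage `j + 1` applies `f` to the `j`-th condition, to `j` and to
`t j`, and the condition at a stage is the coordinatewise union of what came before,
closed off at the top. -/
noncomputable def guidedSeq
    (f : (Ordinal.{u} → Set Ordinal.{u}) → Ordinal.{u} → Ordinal.{u} →
      Ordinal.{u} → Set Ordinal.{u})
    (p : Ordinal.{u} → Set Ordinal.{u}) (t : Ordinal.{u} → Ordinal.{u}) (i : Ordinal.{u}) :
    Ordinal.{u} → Set Ordinal.{u} := fun γ ↦
  topUnion (insert (p γ) {c | ∃ j, ∃ _ : j < i, c = f (guidedSeq f p t j) j (t j) γ})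
termination_by i

theorem guidedSeq_congr
    {f : (Ordinal.{u} → Set Ordinal.{u}) → Ordinal.{u} → Ordinal.{u} →
      Ordinal.{u} → Set Ordinal.{u}}
    {p : Ordinal.{u} → Set Ordinal.{u}} {t t' : Ordinal.{u} → Ordinal.{u}} (i : Ordinal.{u})
    (h : ∀ j < i, t j = t' j) : guidedSeq f p t i = guidedSeq f p t' i := by
  induction i using WellFoundedLT.induction with
  | ind i ih =>
    funext γ
    rw [guidedSeq, guidedSeq]
    congr 3
    ext c
    refine exists_congr fun j ↦ exists_congr fun hj ↦ ?_
    rw [ih j hj fun k hk ↦ h k (hk.trans hj), h j hj]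

theorem Ordinal.exists_forall_lt_of_lt_cof {ι : Type u} {f : ι → Ordinal.{u}} {a : Ordinal.{u}}
    (ha : #ι < a.cof) (hf : ∀ i, f i < a) : ∃ b < a, ∀ i, f i < b := by
  refine ⟨_, Ordinal.iSup_add_one_lt_of_lt_cof ha hf, fun i ↦ ?_⟩
  exact (lt_add_one (f i)).trans_le (Ordinal.le_iSup (fun i ↦ f i + 1) i)

section GuidedSeq

variable {κ δ : Cardinal.{u}} {S : Ordinal.{u} → Set Ordinal.{u}}
  {Ds : Ordinal.{u} → Set (Ordinal.{u} → Set Ordinal.{u})}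
  {f : (Ordinal.{u} → Set Ordinal.{u}) → Ordinal.{u} → Ordinal.{u} →
      Ordinal.{u} → Set Ordinal.{u}}
  {p : Ordinal.{u} → Set Ordinal.{u}} {t : Ordinal.{u} → Ordinal.{u}}

/-- `f q i β` extends the condition `q`, lies in `Ds i`, and has all its maxima above `β`. -/
def IsStepFun (κ δ : Cardinal.{u}) (S : Ordinal.{u} → Set Ordinal.{u})
    (Ds : Ordinal.{u} → Set (Ordinal.{u} → Set Ordinal.{u}))
    (f : (Ordinal.{u} → Set Ordinal.{u}) → Ordinal.{u} → Ordinal.{u} →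
      Ordinal.{u} → Set Ordinal.{u}) : Prop :=
  ∀ q, ProdCond κ δ S q → ∀ i < κ.ord, ∀ β < (Order.succ κ).ord,
    ProdCond κ δ S (f q i β) ∧ f q i β ∈ Ds i ∧ ProdExt δ (f q i β) q ∧
      ∀ γ < δ.ord, β < sSup (f q i β γ)

theorem exists_isStepFun (hκ : ℵ₀ ≤ κ)
    (hS : ∀ γ < δ.ord, ∀ α ∈ S (1 + γ), α.cof = κ)
    (hD : ∀ i < κ.ord, ∀ p, ProdCond κ δ S p →
      ∃ q, ProdCond κ δ S q ∧ q ∈ Ds i ∧ ProdExt δ q p) :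
    ∃ f, IsStepFun κ δ S Ds f := by
  have : ∀ q, ProdCond κ δ S q → ∀ i < κ.ord, ∀ β < (Order.succ κ).ord, ∃ r,
    ProdCond κ δ S r ∧ r ∈ Ds i ∧ ProdExt δ r q ∧ ∀ γ < δ.ord, β < sSup (r γ) := by
    intro q hq i hi β hβ
    let x : Ordinal.{u} → Ordinal.{u} := fun γ ↦ Order.succ (max β (sSup (q γ)))
    have hx : ∀ γ < δ.ord, CUCond (Iio (Order.succ κ).ord \ S (1 + γ)) (Order.succ κ).ord
        (insert (x γ) (q γ)) ∧ CUExt (insert (x γ) (q γ)) (q γ) := by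
      intro γ hγ
      have hlim : Order.IsSuccLimit (Order.succ κ).ord :=
        isSuccLimit_ord (hκ.trans (Order.le_succ κ))
      have hxo : x γ < (Order.succ κ).ord :=
        hlim.succ_lt (max_lt hβ (hq γ hγ).sSup_lt_s16)
      refine (hq γ hγ).insert_of_lt (Order.lt_succ_of_le (le_max_right _ _)) hxo ⟨hxo, fun h ↦ ?_⟩
      have h1 := hS γ hγ _ h
      simp only [x] at h1
      rw [Order.succ_eq_add_one, Ordinal.cof_add_one] at h1
      exact (one_lt_aleph0.trans_le hκ).ne h1
    have hq' : ProdCond κ δ S fun γ ↦ insert (x γ) (q γ) := fun γ hγ ↦ (hx γ hγ).1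
    obtain ⟨r, hr, hrD, hrq⟩ := hD i hi _ hq'
    refine ⟨r, hr, hrD, hrq.trans_of_prodCond (fun γ hγ ↦ (hx γ hγ).2) hq' hq, fun γ hγ ↦ ?_⟩
    refine lt_of_lt_of_le ?_ (hrq.sSup_le hr hq' hγ)
    refine lt_of_lt_of_le (Order.lt_succ_of_le (le_max_left _ _))
      (le_csSup (hq' γ hγ).bddAbove_s16 (mem_insert _ _))
  choose! f hf using this
  exact ⟨f, hf⟩

/-- Stage `i` of `guidedSeq` is a condition extending all earlier steps. -/
def GoodStage (κ δ : Cardinal.{u}) (S : Ordinal.{u} → Set Ordinal.{u})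
    (f : (Ordinal.{u} → Set Ordinal.{u}) → Ordinal.{u} → Ordinal.{u} →
      Ordinal.{u} → Set Ordinal.{u})
    (p : Ordinal.{u} → Set Ordinal.{u}) (t : Ordinal.{u} → Ordinal.{u}) (i : Ordinal.{u}) :
    Prop :=
  ProdCond κ δ S (guidedSeq f p t i) ∧ ProdExt δ (guidedSeq f p t i) p ∧
    ∀ j < i, ProdExt δ (guidedSeq f p t i) (f (guidedSeq f p t j) j (t j))

/-- The sets whose closed-off union is the coordinate `γ` of stage `i`. -/
def stageParts
    (f : (Ordinal.{u} → Set Ordinal.{u}) → Ordinal.{u} → Ordinal.{u} →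
      Ordinal.{u} → Set Ordinal.{u})
    (p : Ordinal.{u} → Set Ordinal.{u}) (t : Ordinal.{u} → Ordinal.{u}) (i γ : Ordinal.{u}) :
    Set (Set Ordinal.{u}) :=
  insert (p γ) {c | ∃ j, ∃ _ : j < i, c = f (guidedSeq f p t j) j (t j) γ}

theorem guidedSeq_apply (i γ : Ordinal.{u}) :
    guidedSeq f p t i γ = topUnion (stageParts f p t i γ) := by
  rw [guidedSeq, stageParts]

theorem cuCond_of_mem_stageParts (hf : IsStepFun κ δ S Ds f) (hp : ProdCond κ δ S p)
    (ht : ∀ j, t j < (Order.succ κ).ord) {i : Ordinal.{u}} (hi : i ≤ κ.ord)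
    (ih : ∀ j < i, GoodStage κ δ S f p t j) {γ : Ordinal.{u}} (hγ : γ < δ.ord) :
    ∀ c ∈ stageParts f p t i γ,
      CUCond (Iio (Order.succ κ).ord \ S (1 + γ)) (Order.succ κ).ord c := by
  rintro c (rfl | ⟨j, hj, rfl⟩)
  · exact hp γ hγ
  · exact (hf _ (ih j hj).1 j (hj.trans_le hi) _ (ht j)).1 γ hγ

theorem cuExt_or_of_mem_stageParts (hf : IsStepFun κ δ S Ds f) (hp : ProdCond κ δ S p)
    (ht : ∀ j, t j < (Order.succ κ).ord) {i : Ordinal.{u}} (hi : i ≤ κ.ord)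
    (ih : ∀ j < i, GoodStage κ δ S f p t j) {γ : Ordinal.{u}} (hγ : γ < δ.ord) :
    ∀ c ∈ stageParts f p t i γ, ∀ d ∈ stageParts f p t i γ, CUExt c d ∨ CUExt d c := by
  have hstep : ∀ j, ∀ hj : j < i, _ := fun j hj ↦
    hf _ (ih j hj).1 j (hj.trans_le hi) _ (ht j)
  have hext : ∀ j < i, ProdExt δ (f (guidedSeq f p t j) j (t j)) p := fun j hj ↦
    (hstep j hj).2.2.1.trans_of_prodCond (ih j hj).2.1 (ih j hj).1 hp
  have hlt : ∀ j k, j < k → k < i →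
      ProdExt δ (f (guidedSeq f p t k) k (t k)) (f (guidedSeq f p t j) j (t j)) :=
    fun j k hjk hk ↦ (hstep k hk).2.2.1.trans_of_prodCond ((ih k hk).2.2 j hjk) (ih k hk).1
      (hstep j (hjk.trans hk)).1
  rintro c (rfl | ⟨j, hj, rfl⟩) d (rfl | ⟨k, hk, rfl⟩)
  · exact Or.inl (hp.ext_refl γ hγ)
  · exact Or.inr (hext k hk γ hγ)
  · exact Or.inl (hext j hj γ hγ)
  · rcases lt_trichotomy j k with h | rfl | h
    · exact Or.inr (hlt j k h hk γ hγ)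
    · exact Or.inl ((hstep j hj).1.ext_refl γ hγ)
    · exact Or.inl (hlt k j h hj γ hγ)

theorem goodStage_of_sSup (hf : IsStepFun κ δ S Ds f) (hp : ProdCond κ δ S p)
    (ht : ∀ j, t j < (Order.succ κ).ord) {i : Ordinal.{u}} (hi : i ≤ κ.ord)
    (ih : ∀ j < i, GoodStage κ δ S f p t j)
    (hs : ∀ γ < δ.ord, sSup (⋃₀ stageParts f p t i γ) < (Order.succ κ).ord)
    (hS : ∀ γ < δ.ord, sSup (⋃₀ stageParts f p t i γ) ∉ S (1 + γ)) :
    GoodStage κ δ S f p t i := by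
  have hA {γ : Ordinal.{u}} (hγ : γ < δ.ord) := cuCond_of_mem_stageParts hf hp ht hi ih hγ
  have hch {γ : Ordinal.{u}} (hγ : γ < δ.ord) := cuExt_or_of_mem_stageParts hf hp ht hi ih hγ
  have hb : ∀ γ < δ.ord, BddAbove (⋃₀ stageParts f p t i γ) := fun γ hγ ↦
    bddAbove_of_subset_Iio (o := (Order.succ κ).ord) <| by
      rintro x ⟨c, hc, hx⟩
      exact (hA hγ c hc).2.2.1 hx
  have hex : ∀ γ < δ.ord, ∀ c ∈ stageParts f p t i γ, CUExt (guidedSeq f p t i γ) c := by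
    intro γ hγ c hc
    rw [guidedSeq_apply]
    exact CUExt.topUnion (fun c hc ↦ (hA hγ c hc).sSup_mem_s16) (hb γ hγ) (hch hγ) hc
  refine ⟨fun γ hγ ↦ ?_, fun γ hγ ↦ hex γ hγ _ (mem_insert _ _),
    fun j hj γ hγ ↦ hex γ hγ _ (Or.inr ⟨j, hj, rfl⟩)⟩
  rw [guidedSeq_apply]
  exact CUCond.topUnion (hA hγ) (hch hγ) (hs γ hγ) ⟨hs γ hγ, hS γ hγ⟩

theorem goodStage_of_lt (hκ : ℵ₀ ≤ κ) (hS : ∀ γ < δ.ord, ∀ α ∈ S (1 + γ), α.cof = κ)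
    (hf : IsStepFun κ δ S Ds f) (hp : ProdCond κ δ S p)
    (ht : ∀ j, t j < (Order.succ κ).ord) (i : Ordinal.{u}) (hi : i < κ.ord) :
    GoodStage κ δ S f p t i := by
  induction i using WellFoundedLT.induction with
  | ind i ih' =>
    have ih : ∀ j < i, GoodStage κ δ S f p t j := fun j hj ↦ ih' j hj (hj.trans hi)
    have hA {γ : Ordinal.{u}} (hγ : γ < δ.ord) := cuCond_of_mem_stageParts hf hp ht hi.le ih hγ
    have hcard : #(Option i.ToType) < κ := by
      rw [mk_option, mk_toType]
      exact add_lt_of_lt hκ (lt_ord.1 hi) (one_lt_aleph0.trans_le hκ)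
    let g : Ordinal.{u} → Option i.ToType → Ordinal.{u} := fun γ x ↦
      x.elim (sSup (p γ)) fun y ↦
        sSup (f (guidedSeq f p t y.toOrd) y.toOrd (t y.toOrd) γ)
    have hg : ∀ γ, ∀ x, ∃ c ∈ stageParts f p t i γ, g γ x = sSup c := by
      rintro γ (_ | y)
      · exact ⟨_, mem_insert _ _, rfl⟩
      · exact ⟨_, Or.inr ⟨_, y.toOrd.2, rfl⟩, rfl⟩
    have hle : ∀ γ < δ.ord, ∀ x ∈ ⋃₀ stageParts f p t i γ, ∃ y, x ≤ g γ y := by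
      rintro γ hγ x ⟨c, hc, hx⟩
      have hxc := le_csSup (hA hγ c hc).bddAbove_s16 hx
      rcases hc with rfl | ⟨j, hj, rfl⟩
      · exact ⟨none, hxc⟩
      · refine ⟨some (Ordinal.ToType.mk ⟨j, hj⟩), ?_⟩
        simpa [g] using hxc
    have hbound : ∀ γ < δ.ord, ∀ a : Ordinal.{u}, κ ≤ a.cof → (∀ y, g γ y < a) →
        sSup (⋃₀ stageParts f p t i γ) < a := by
      intro γ hγ a ha hga
      obtain ⟨b, hb, hb'⟩ := Ordinal.exists_forall_lt_of_lt_cof (hcard.trans_le ha) hga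
      refine (csSup_le' fun x hx ↦ ?_).trans_lt hb
      obtain ⟨y, hy⟩ := hle γ hγ x hx
      exact hy.trans (hb' y).le
    refine goodStage_of_sSup hf hp ht hi.le ih (fun γ hγ ↦ hbound γ hγ _ ?_ ?_) fun γ hγ h ↦ ?_
    · rw [(isRegular_succ hκ).cof_ord]
      exact Order.le_succ κ
    · intro y
      obtain ⟨c, hc, h⟩ := hg γ y
      exact h ▸ (hA hγ c hc).sSup_lt_s16
    · refine (hbound γ hγ _ (hS γ hγ _ h).ge fun y ↦ ?_).false
      obtain ⟨c, hc, hy⟩ := hg γ y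
      have hmem := (hA hγ c hc).sSup_mem_s16
      rw [hy]
      refine lt_of_le_of_ne (le_csSup (bddAbove_of_subset_Iio (o := (Order.succ κ).ord) ?_)
        ⟨c, hc, hmem⟩) fun e ↦ ?_
      · rintro x ⟨d, hd, hx⟩
        exact (hA hγ d hd).2.2.1 hx
      · exact ((hA hγ c hc).2.1 hmem).2 (e ▸ h)

/-- Below `η`, all stages of length `< κ` have their maxima below `θ`. -/
def BoundsStages (κ δ : Cardinal.{u})
    (f : (Ordinal.{u} → Set Ordinal.{u}) → Ordinal.{u} → Ordinal.{u} →
      Ordinal.{u} → Set Ordinal.{u})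
    (p : Ordinal.{u} → Set Ordinal.{u}) (η θ : Ordinal.{u}) : Prop :=
  ∀ i < κ.ord, ∀ t : Ordinal.{u} → Ordinal.{u}, (∀ j < i, t j < η) →
    ∀ γ < δ.ord, sSup (guidedSeq f p t i γ) < θ

theorem mk_sigma_bounded_le (hκ : ℵ₀ ≤ κ) (hpow : κ ^< κ = κ) (hδκ : δ ≤ κ) {η : Ordinal.{u}}
    (hη : η < (Order.succ κ).ord) :
    #((Σ i : κ.ord.ToType, i.toOrd.1.ToType → η.ToType) × δ.ord.ToType) ≤ κ := by
  have hη' : η.card ≤ κ := Order.lt_succ_iff.1 (lt_ord.1 hη)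
  rw [mk_prod, lift_id, lift_id, mk_sigma, mk_ord_toType]
  refine (mul_le_mul' (sum_le_mk_mul_iSup _) hδκ).trans ?_
  rw [mk_ord_toType]
  refine (mul_le_mul' (mul_le_mul' le_rfl (ciSup_le' fun i ↦ ?_)) le_rfl).trans
    (?_ : κ * κ * κ ≤ κ)
  · have hi : i.toOrd.1.card < κ := lt_ord.1 i.toOrd.2
    simp only [mk_pi, prod_const, lift_id, mk_toType]
    exact (power_le_power_right hη').trans ((le_powerlt κ hi).trans hpow.le)
  · rw [mul_eq_self hκ, mul_eq_self hκ]

theorem exists_boundsStages (hκ : ℵ₀ ≤ κ) (hpow : κ ^< κ = κ) (hδκ : δ ≤ κ)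
    (hS : ∀ γ < δ.ord, ∀ α ∈ S (1 + γ), α.cof = κ)
    (hf : IsStepFun κ δ S Ds f) (hp : ProdCond κ δ S p) {η : Ordinal.{u}}
    (hη : η < (Order.succ κ).ord) :
    ∃ θ < (Order.succ κ).ord, BoundsStages κ δ f p η θ := by
  let ext : (Σ i : κ.ord.ToType, i.toOrd.1.ToType → η.ToType) → Ordinal.{u} → Ordinal.{u} :=
    fun x j ↦ if h : j < x.1.toOrd.1 then (x.2 (Ordinal.ToType.mk ⟨j, h⟩)).toOrd.1 else 0
  have hext : ∀ x j, ext x j < (Order.succ κ).ord := by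
    intro x j
    simp only [ext]
    split_ifs with h
    · exact (Subtype.prop (Ordinal.ToType.toOrd _)).trans hη
    · exact (isRegular_succ hκ).ord_pos
  obtain ⟨θ, hθ, hb⟩ := Ordinal.exists_forall_lt_of_lt_cof (a := (Order.succ κ).ord)
    (f := fun x : (Σ i : κ.ord.ToType, i.toOrd.1.ToType → η.ToType) × δ.ord.ToType ↦
      sSup (guidedSeq f p (ext x.1) x.1.1.toOrd x.2.toOrd))
    (by
      rw [(isRegular_succ hκ).cof_ord]
      exact Order.lt_succ_of_le (mk_sigma_bounded_le hκ hpow hδκ hη))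
    (fun x ↦ ((goodStage_of_lt hκ hS hf hp (hext x.1) _ x.1.1.toOrd.2).1 _ x.2.toOrd.2).sSup_lt_s16)
  refine ⟨θ, hθ, fun i hi t ht γ hγ ↦ ?_⟩
  let i' : κ.ord.ToType := Ordinal.ToType.mk ⟨i, hi⟩
  have hi' : i'.toOrd.1 = i := by simp [i']
  let x : (Σ i : κ.ord.ToType, i.toOrd.1.ToType → η.ToType) :=
    ⟨i', fun y ↦ Ordinal.ToType.mk ⟨t y.toOrd, ht _ (y.toOrd.2.trans_eq hi')⟩⟩
  have := hb (x, Ordinal.ToType.mk ⟨γ, hγ⟩)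
  have hx : guidedSeq f p (ext x) i = guidedSeq f p t i := by
    refine guidedSeq_congr i fun j hj ↦ ?_
    have hj' : j < x.1.toOrd.1 := hj.trans_eq hi'.symm
    simp only [ext, dif_pos hj']
    simp [x]
  have hx1 : x.1.toOrd.1 = i := hi'
  simpa only [hx1, hx, Ordinal.ToType.toOrd, OrderIso.symm_apply_apply] using this

theorem isClubIn_boundsStages (hκ : ℵ₀ ≤ κ)
    (h : ∀ η < (Order.succ κ).ord, ∃ θ < (Order.succ κ).ord, BoundsStages κ δ f p η θ) :
    IsClubIn {θ | θ < (Order.succ κ).ord ∧ ∀ η < θ, BoundsStages κ δ f p η θ}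
      (Order.succ κ).ord := by
  refine ⟨fun θ hθ ↦ hθ.1, fun α hα h0 hs ↦ ⟨hα, fun η hη i hi t ht γ hγ ↦ ?_⟩, fun α hα ↦ ?_⟩
  · obtain ⟨θ, ⟨⟨-, hθ⟩, hθα⟩, hηθ⟩ := exists_lt_of_lt_csSup' (hη.trans_eq hs.symm)
    exact (hθ η hηθ i hi t ht γ hγ).trans hθα
  · choose! b hb hb' using h
    have hreg : Cardinal.IsRegular (Order.succ κ) := isRegular_succ hκ
    have hlim : Order.IsSuccLimit (Order.succ κ).ord := isSuccLimit_ord hreg.1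
    let a : ℕ → Ordinal.{u} := fun n ↦
      n.rec (Order.succ α) fun _ x ↦ max (Order.succ x) (b x)
    have ha : ∀ n, a n < (Order.succ κ).ord := by
      intro n
      induction n with
      | zero => exact hlim.succ_lt hα
      | succ n ih => exact max_lt (hlim.succ_lt ih) (hb _ ih)
    have hle : ∀ n, a n ≤ ⨆ n, a n := fun n ↦ le_ciSup Ordinal.bddAbove_of_small n
    refine ⟨⨆ n, a n, ⟨?_, fun η hη i hi t ht γ hγ ↦ ?_⟩,
      (Order.lt_succ α).trans_le (hle 0)⟩
    · refine Ordinal.lift_iSup_lt_of_lt_cof ?_ ha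
      rw [← Ordinal.lift_cof, hreg.cof_ord]
      simpa using hκ
    · obtain ⟨n, hn⟩ := exists_lt_of_lt_ciSup' hη
      refine (hb' _ (ha n) i hi t (fun j hj ↦ (ht j hj).trans hn) γ hγ).trans_le ?_
      exact (le_max_right (Order.succ (a n)) _).trans (hle (n + 1))

end GuidedSeq

/-- A cofinal sequence of length `o.cof.ord`. -/
theorem Ordinal.exists_cofinal_seq {o : Ordinal.{u}} (h0 : o ≠ 0) :
    ∃ t : Ordinal.{u} → Ordinal.{u}, (∀ j, t j < o) ∧ ∀ a < o, ∃ j < o.cof.ord, a ≤ t j := by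
  obtain ⟨s, hs, hcard⟩ := Order.exists_cof_eq o.ToType
  rw [Ordinal.cof_toType, ← mk_ord_toType o.cof] at hcard
  obtain ⟨e⟩ := Cardinal.eq.1 hcard
  refine ⟨fun j ↦ if h : j < o.cof.ord then (e.symm (ToType.mk ⟨j, h⟩)).1.toOrd.1 else 0,
    fun j ↦ ?_, fun a ha ↦ ?_⟩
  · dsimp only
    split_ifs with h
    · exact Subtype.prop (ToType.toOrd _)
    · exact pos_iff_ne_zero.2 h0
  · obtain ⟨x, hx, hax⟩ := hs (ToType.mk ⟨a, ha⟩)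
    refine ⟨(e ⟨x, hx⟩).toOrd.1, (e ⟨x, hx⟩).toOrd.2, ?_⟩
    have h := (e ⟨x, hx⟩).toOrd.2
    rw [mem_Iio] at h
    dsimp only
    rw [dif_pos h]
    have hax' := ToType.mk.symm.monotone hax
    have he : ToType.mk ⟨(e ⟨x, hx⟩).toOrd.1, h⟩ = e ⟨x, hx⟩ := ToType.mk.apply_symm_apply _
    rw [he, e.symm_apply_apply]
    simpa [ToType.toOrd, ← Subtype.coe_le_coe] using hax'

/-- for every stationary `T ⊆ E^{κ⁺}_κ \ ⋃_{γ<δ} S_{1+γ}`, every sequence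
of `κ` many dense open subsets of the product, and every condition, there are `θ ∈ T` and
an extension lying in the intersection of the dense open sets all of whose coordinates
have maximum `θ`. -/
theorem stmt16
    (κ : Cardinal.{u}) (hκ : Cardinal.aleph0 ≤ κ)
    (hpow : Cardinal.powerlt κ κ = κ)
    (δ : Cardinal.{u}) (hδ : δ.IsRegular) (hδκ : δ ≤ κ)
    (S : Ordinal.{u} → Set Ordinal.{u})
    (hSsub : ∀ γ < δ.ord, S γ ⊆
      {α : Ordinal.{u} | α < (Order.succ κ).ord ∧ α.cof = κ})
    (hSstat : ∀ γ < δ.ord, IsStationaryIn (S γ) (Order.succ κ).ord)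
    (hSdisj : ∀ γ < δ.ord, ∀ γ' < δ.ord, γ ≠ γ' → Disjoint (S γ) (S γ')) :
    ∀ T : Set Ordinal.{u}, IsStationaryIn T (Order.succ κ).ord →
      T ⊆ {α : Ordinal.{u} | α < (Order.succ κ).ord ∧ α.cof = κ} →
      (∀ γ < δ.ord, Disjoint T (S (1 + γ))) →
      ∀ Ds : Ordinal.{u} → Set (Ordinal.{u} → Set Ordinal.{u}),
        (∀ i < κ.ord,
          (∀ p, ProdCond κ δ S p → ∃ q, ProdCond κ δ S q ∧ q ∈ Ds i ∧ ProdExt δ q p) ∧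
          (∀ q ∈ Ds i, ProdCond κ δ S q →
            ∀ q', ProdCond κ δ S q' → ProdExt δ q' q → q' ∈ Ds i)) →
        ∀ p, ProdCond κ δ S p →
          ∃ θ ∈ T, ∃ q, ProdCond κ δ S q ∧ ProdExt δ q p ∧
            (∀ i < κ.ord, q ∈ Ds i) ∧ ∀ γ < δ.ord, sSup (q γ) = θ := by
  intro T hT hTsub hTS Ds hDs p hp
  have hS : ∀ γ < δ.ord, ∀ α ∈ S (1 + γ), α.cof = κ := fun γ hγ α hα ↦
    (hSsub _ (Ordinal.isPrincipal_add_ord hδ.1 (lt_ord.2 (by simpa using hδ.nat_lt 1)) hγ) hα).2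
  obtain ⟨f, hf⟩ := exists_isStepFun hκ hS fun i hi ↦ (hDs i hi).1
  obtain ⟨θ, hθT, hθ, hθb⟩ := hT.2 _ <| isClubIn_boundsStages hκ fun η hη ↦
    exists_boundsStages hκ hpow hδκ hS hf hp hη
  have hcof : θ.cof = κ := (hTsub hθT).2
  have hθ0 : θ ≠ 0 := by
    rintro rfl
    rw [Ordinal.cof_zero] at hcof
    exact (aleph0_pos.trans_le hκ).ne hcof
  obtain ⟨t, htθ, htcof⟩ := Ordinal.exists_cofinal_seq hθ0
  rw [hcof] at htcof
  have ht : ∀ j, t j < (Order.succ κ).ord := fun j ↦ (htθ j).trans hθ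
  have hgood := goodStage_of_lt hκ hS hf hp ht
  have hsup : ∀ i < κ.ord, ∀ γ < δ.ord, sSup (guidedSeq f p t i γ) < θ := by
    intro i hi γ hγ
    obtain ⟨η, hη, hηt⟩ := Ordinal.exists_forall_lt_of_lt_cof (a := θ)
      (f := fun x : i.ToType ↦ t x.toOrd)
      (by rw [mk_toType, hcof]; exact lt_ord.1 hi) fun x ↦ htθ _
    refine hθb η hη i hi t (fun j hj ↦ ?_) γ hγ
    simpa [Ordinal.ToType.toOrd] using hηt (Ordinal.ToType.mk ⟨j, hj⟩)
  have hlim : Order.IsSuccLimit κ.ord := isSuccLimit_ord hκ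
  have hstep : ∀ j, ∀ hj : j < κ.ord, _ := fun j hj ↦ hf _ (hgood j hj).1 j hj _ (ht j)
  have hpart : ∀ γ < δ.ord, ∀ x ∈ ⋃₀ stageParts f p t κ.ord γ, x < θ := by
    rintro γ hγ x ⟨c, rfl | ⟨j, hj, rfl⟩, hx⟩
    · have h0 : (0 : Ordinal.{u}) < κ.ord := hlim.bot_lt
      exact (le_csSup ((hgood 0 h0).1 γ hγ).bddAbove_s16
        (((hgood 0 h0).2.1 γ hγ).subset_s16 hx)).trans_lt (hsup 0 h0 γ hγ)
    · have hj' := hlim.succ_lt hj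
      exact (le_csSup ((hgood _ hj').1 γ hγ).bddAbove_s16
        (((hgood _ hj').2.2 j (Order.lt_succ j) γ hγ).subset_s16 hx)).trans_lt (hsup _ hj' γ hγ)
  have hbdd : ∀ γ < δ.ord, BddAbove (⋃₀ stageParts f p t κ.ord γ) := fun γ hγ ↦
    bddAbove_of_subset_Iio (hpart γ hγ)
  have htop : ∀ γ < δ.ord, sSup (⋃₀ stageParts f p t κ.ord γ) = θ := by
    intro γ hγ
    refine le_antisymm (csSup_le' fun x hx ↦ (hpart γ hγ x hx).le) (le_of_forall_lt fun a ha ↦ ?_)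
    obtain ⟨j, hj, haj⟩ := htcof a ha
    refine haj.trans_lt (((hstep j hj).2.2.2 γ hγ).trans_le (le_csSup (hbdd γ hγ) ?_))
    exact ⟨_, Or.inr ⟨j, hj, rfl⟩, ((hstep j hj).1 γ hγ).sSup_mem_s16⟩
  have hfin : GoodStage κ δ S f p t κ.ord :=
    goodStage_of_sSup hf hp ht le_rfl hgood (fun γ hγ ↦ (htop γ hγ).trans_lt hθ)
      fun γ hγ h ↦ (hTS γ hγ).notMem_of_mem_left hθT (htop γ hγ ▸ h)
  refine ⟨θ, hθT, _, hfin.1, hfin.2.1, fun i hi ↦ ?_, fun γ hγ ↦ ?_⟩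
  · exact (hDs i hi).2 _ (hstep i hi).2.1 (hstep i hi).1 _ hfin.1 (hfin.2.2 i hi)
  · rw [guidedSeq_apply, sSup_topUnion (hbdd γ hγ), htop γ hγ]
end
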